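/- arXiv:1308.4251 — 5 statements merged into one kernel-verified Lean document; each statement's English description precedes it below -/
import Mathlib

section
/- If $G$ is a unicyclic graph of order $n \geq 3$ whose unique cycle has length $g \geq 4$, then $rx_3(G) = n-2$. -/
open SimpleGraph

/-- An edge-coloring `c` is a `k`-rainbow coloring of `G` if every `k`-set of vertices
is contained in a rainbow tree: a subgraph of `G` that is a tree, contains the `k` vertices,
and whose edges receive pairwise distinct colors. -/
def IsRainbowColoring {V : Type*} [Fintype V] (G : SimpleGraph V) {α : Type*}
    (c : Sym2 V → α) (k : ℕ) : Prop :=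
  ∀ S : Finset V, S.card = k →
    ∃ T : G.Subgraph, (↑S : Set V) ⊆ T.verts ∧ T.coe.IsTree ∧ Set.InjOn c T.edgeSet

/-- The `k`-rainbow index of `G`: the minimum number of colors in a `k`-rainbow coloring. -/
noncomputable def rxk {V : Type*} [Fintype V] (G : SimpleGraph V) (k : ℕ) : ℕ :=
  sInf {q | ∃ c : Sym2 V → Fin q, IsRainbowColoring G c k}

namespace SimpleGraph

variable {V : Type*} {G : SimpleGraph V}

/-- The closed sequence `v 0, …, v g = v 0` traverses a cycle with edge set `C`, and `ρ x` is the
index of the cycle vertex whose branch (component after deleting `C`) contains `x`. -/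
structure IsCycleLabelling (G : SimpleGraph V) (C : Set (Sym2 V)) (g : ℕ) (v : ℕ → V)
    (ρ : V → ℕ) : Prop where
  mem_iff : ∀ e, e ∈ C ↔ ∃ k < g, s(v k, v (k + 1)) = e
  closed : v g = v 0
  adj : ∀ k < g, G.Adj (v k) (v (k + 1))
  lt : ∀ x, ρ x < g
  label : ∀ k < g, ρ (v k) = k
  reachable : ∀ x, (G.deleteEdges C).Reachable x (v (ρ x))
  label_eq : ∀ x y, G.Adj x y → s(x, y) ∉ C → ρ x = ρ y

/-- Consecutive adjacencies give reachability. -/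
lemma reachable_of_forall_adj {v : ℕ → V} {a b : ℕ} (hab : a ≤ b)
    (h : ∀ k, a ≤ k → k < b → G.Adj (v k) (v (k + 1))) : G.Reachable (v a) (v b) := by
  induction b, hab using Nat.le_induction with
  | base => rfl
  | succ b hb ih =>
    exact (ih fun k h₁ h₂ => h k h₁ (by omega)).trans (h b hb (by omega)).reachable

/-- Deleting a cycle edge from a connected graph with as many edges as vertices leaves a tree. -/
lemma isTree_deleteEdges_of_mem_cycle [Fintype V] (hG : G.Connected)
    (huni : G.edgeSet.ncard = Fintype.card V) {u : V} {p : G.Walk u u} (hp : p.IsCycle)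
    {e : Sym2 V} (he : e ∈ p.edges) : (G.deleteEdges {e}).IsTree := by
  have hb : ¬ G.IsBridge e := fun h => h.notMem_edges_of_isCycle hp he
  have heG : e ∈ G.edgeSet := p.edges_subset_edgeSet he
  rw [isTree_iff_connected_and_card]
  constructor
  · induction e with | h x y => exact hG.connected_delete_edge_of_not_isBridge hb
  · rw [Nat.card_coe_set_eq, edgeSet_deleteEdges, Set.ncard_sdiff_singleton_add_one heG, huni,
      Nat.card_eq_fintype_card]

/-- Once a cycle edge is deleted, every other edge separates its ends. -/
lemma not_reachable_of_mem_cycle [Fintype V] (hG : G.Connected)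
    (huni : G.edgeSet.ncard = Fintype.card V) {u : V} {p : G.Walk u u} (hp : p.IsCycle)
    {x y : V} (hxy : G.Adj x y) {e : Sym2 V} (he : e ∈ p.edges) (hne : s(x, y) ≠ e) :
    ¬ ((G.deleteEdges {e}).deleteEdges {s(x, y)}).Reachable x y := by
  rw [← isBridge_iff]
  refine isAcyclic_iff_forall_isBridge.1
    (isTree_deleteEdges_of_mem_cycle hG huni hp he).isAcyclic ?_
  rw [edgeSet_deleteEdges]
  exact ⟨hxy, hne⟩

/-- The cycle of a unicyclic graph can be labelled starting from the branch of any vertex. -/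
lemma exists_isCycleLabelling [Fintype V] (hG : G.Connected)
    (huni : G.edgeSet.ncard = Fintype.card V) {u : V} {p : G.Walk u u} (hp : p.IsCycle) (x₀ : V) :
    ∃ v ρ, IsCycleLabelling G {e | e ∈ p.edges} p.length v ρ ∧ ρ x₀ = 0 := by
  classical
  have hex : ∀ x, ∃ w ∈ p.support, (G.deleteEdges {e | e ∈ p.edges}).Reachable x w := by
    intro x
    obtain ⟨q⟩ := hG.preconnected x u
    induction q with
    | nil => exact ⟨_, p.start_mem_support, .rfl⟩
    | @cons a b _ hab q ih =>
      obtain ⟨w, hw, hr⟩ := ih hp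
      by_cases hC : s(a, b) ∈ p.edges
      · exact ⟨a, p.fst_mem_support_of_mem_edges hC, .rfl⟩
      · refine ⟨w, hw, Reachable.trans (Adj.reachable ?_) hr⟩
        simpa [hab] using hC
  obtain ⟨w₀, hw₀, hr₀⟩ := hex x₀
  have hq : (p.rotate w₀ hw₀).IsCycle := hp.rotate hw₀
  have hqe : ∀ e, e ∈ (p.rotate w₀ hw₀).edges ↔ e ∈ p.edges :=
    fun e => (p.rotate_edges w₀ hw₀).mem_iff
  have hqs : ∀ y, y ∈ (p.rotate w₀ hw₀).support ↔ y ∈ p.support :=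
    fun y => p.mem_support_rotate_iff w₀ hw₀
  have hlen := p.length_rotate w₀ hw₀
  have hset : {e | e ∈ p.edges} = {e | e ∈ (p.rotate w₀ hw₀).edges} := by
    ext e; exact (hqe e).symm
  rw [hset, ← hlen]
  rw [hset] at hex hr₀
  simp only [← hqs] at hex
  generalize p.rotate w₀ hw₀ = q at *
  have h3 := hq.three_le_length
  have hmem : ∀ e, e ∈ {e | e ∈ q.edges} ↔ ∃ k < q.length, s(q.getVert k, q.getVert (k + 1)) = e := by
    intro e
    induction e with | h a b => exact q.mk_mem_edges_iff_exists
  have hclosed : q.getVert q.length = q.getVert 0 := by simp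
  have hinj : ∀ i j, i < q.length → j < q.length → q.getVert i = q.getVert j → i = j :=
    fun i j hi hj h => hq.getVert_injOn' (by simp; omega) (by simp; omega) h
  have hadj : ∀ k < q.length, G.Adj (q.getVert k) (q.getVert (k + 1)) :=
    fun k hk => q.adj_getVert_succ hk
  have hne : ∀ i j, i < j → j < q.length →
      s(q.getVert i, q.getVert (i + 1)) ≠ s(q.getVert j, q.getVert (j + 1)) := by
    intro i j hij hj h
    rw [Sym2.eq_iff] at h
    rcases h with ⟨h, -⟩ | ⟨h, h'⟩
    · have := hinj _ _ (by omega) hj h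
      omega
    · have h1 := hinj _ _ (by omega) hj h'
      by_cases hj' : j + 1 < q.length
      · have := hinj _ _ (by omega) hj' h
        omega
      · rw [show j + 1 = q.length by omega, hclosed] at h
        have := hinj _ _ (by omega) (by omega) h
        omega
  have hsep : ∀ i j, i < j → j < q.length →
      ¬ (G.deleteEdges {e | e ∈ q.edges}).Reachable (q.getVert i) (q.getVert j) := by
    intro i j hij hj hr
    have hmemk : ∀ k < q.length, s(q.getVert k, q.getVert (k + 1)) ∈ q.edges :=
      fun k hk => (hmem _).2 ⟨k, hk, rfl⟩
    refine not_reachable_of_mem_cycle hG huni hq (hadj i (by omega)) (hmemk j hj)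
      (hne i j hij hj) ?_
    rw [deleteEdges_deleteEdges]
    refine (hr.mono (deleteEdges_anti ?_)).trans ?_
    · rintro e (rfl | rfl)
      exacts [hmemk j hj, hmemk i (by omega)]
    · refine (reachable_of_forall_adj (v := q.getVert) (by omega) fun k h1 h2 => ?_).symm
      rw [deleteEdges_adj]
      refine ⟨hadj k (by omega), ?_⟩
      rintro (h | h)
      exacts [hne _ _ h2 hj h, hne _ _ (show i < k by omega) (by omega) h.symm]
  have huniq : ∀ i j, i < q.length → j < q.length →
      (G.deleteEdges {e | e ∈ q.edges}).Reachable (q.getVert i) (q.getVert j) → i = j := by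
    intro i j hi hj hr
    rcases lt_trichotomy i j with h | h | h
    exacts [(hsep i j h hj hr).elim, h, (hsep j i h hi hr.symm).elim]
  have hex' : ∀ x, ∃ k < q.length,
      (G.deleteEdges {e | e ∈ q.edges}).Reachable x (q.getVert k) := by
    intro x
    obtain ⟨w, hw, hr⟩ := hex x
    obtain ⟨k, rfl, hk⟩ := Walk.mem_support_iff_exists_getVert.1 hw
    rcases hk.lt_or_eq with hk | rfl
    · exact ⟨k, hk, hr⟩
    · exact ⟨0, by omega, hclosed ▸ hr⟩
  choose ρ hρ hρr using hex'
  refine ⟨q.getVert, ρ, ⟨hmem, hclosed, hadj, hρ, ?_, hρr, ?_⟩, ?_⟩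
  · exact fun k hk => (huniq _ _ hk (hρ _) (hρr _)).symm
  · intro x y hxy hC
    refine huniq _ _ (hρ _) (hρ _) ((hρr x).symm.trans (Reachable.trans (Adj.reachable ?_) (hρr y)))
    rw [deleteEdges_adj]
    exact ⟨hxy, hC⟩
  · refine huniq _ _ (hρ _) (by omega) ((hρr x₀).symm.trans ?_)
    simpa using hr₀

namespace IsCycleLabelling

variable {C : Set (Sym2 V)} {g : ℕ} {v : ℕ → V} {ρ : V → ℕ}

lemma label_succ (h : IsCycleLabelling G C g v ρ) {k : ℕ} (hk : k < g) :
    ρ (v (k + 1)) = if k + 1 = g then 0 else k + 1 := by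
  split_ifs with hg
  · rw [hg, h.closed, h.label 0 (by omega)]
  · exact h.label _ (by omega)

lemma edge_injOn (h : IsCycleLabelling G C g v ρ) (hg : 3 ≤ g) {i j : ℕ} (hi : i < g) (hj : j < g)
    (he : s(v i, v (i + 1)) = s(v j, v (j + 1))) : i = j := by
  have h1 := h.label i hi
  have h2 := h.label j hj
  have h3 := h.label_succ hi
  have h4 := h.label_succ hj
  rw [Sym2.eq_iff] at he
  rcases he with ⟨ha, hb⟩ | ⟨ha, hb⟩
  · rw [← h1, ha, h2]
  · rw [ha, h4] at h1
    rw [hb, h2] at h3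
    split_ifs at h1 h3 <;> omega

end IsCycleLabelling

lemma Subgraph.Connected.iff_of_forall_adj {T : G.Subgraph} (hT : T.coe.Connected) {P : V → Prop}
    (hP : ∀ x y, T.Adj x y → (P x ↔ P y)) {x y : V} (hx : x ∈ T.verts) (hy : y ∈ T.verts) :
    P x ↔ P y := by
  obtain ⟨w⟩ := hT.preconnected ⟨x, hx⟩ ⟨y, hy⟩
  suffices ∀ a b : T.verts, T.coe.Walk a b → (P a ↔ P b) from this _ _ w
  intro a b w
  induction w with
  | nil => rfl
  | cons hab _ ih => exact (hP _ _ hab).trans ih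

/-- Two missing cycle edges separate the branches strictly between them from the others. -/
lemma IsCycleLabelling.mem_Ioc_iff {C : Set (Sym2 V)} {g : ℕ} {v : ℕ → V} {ρ : V → ℕ}
    (h : IsCycleLabelling G C g v ρ) {T : G.Subgraph} (hT : T.coe.Connected)
    {i j : ℕ} (hij : i < j) (hj : j < g) (hi' : s(v i, v (i + 1)) ∉ T.edgeSet)
    (hj' : s(v j, v (j + 1)) ∉ T.edgeSet) {x y : V} (hx : x ∈ T.verts) (hy : y ∈ T.verts) :
    (i < ρ x ∧ ρ x ≤ j) ↔ (i < ρ y ∧ ρ y ≤ j) := by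
  refine Subgraph.Connected.iff_of_forall_adj hT (P := fun x => i < ρ x ∧ ρ x ≤ j) ?_ hx hy
  intro a b hab
  by_cases hC : s(a, b) ∈ C
  · obtain ⟨k, hk, he⟩ := (h.mem_iff _).1 hC
    have hkT : s(v k, v (k + 1)) ∈ T.edgeSet := by rw [he]; exact hab
    have hki : k ≠ i := by rintro rfl; exact hi' hkT
    have hkj : k ≠ j := by rintro rfl; exact hj' hkT
    have h1 := h.label k hk
    have h2 := h.label_succ hk
    rw [Sym2.eq_iff] at he
    rcases he with ⟨rfl, rfl⟩ | ⟨rfl, rfl⟩ <;> rw [h1, h2] <;> split_ifs <;> omega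
  · rw [h.label_eq a b hab.adj_sub hC]

/-- Beyond every noncycle edge `b` there is a vertex joined to the cycle only through `b`. -/
lemma exists_forced_vertex [Fintype V] (hG : G.Connected)
    (huni : G.edgeSet.ncard = Fintype.card V) {u : V} {p : G.Walk u u} (hp : p.IsCycle)
    {b : Sym2 V} (hb : b ∈ G.edgeSet) (hbp : b ∉ p.edges) :
    ∃ x, ∀ T : G.Subgraph, T.coe.Connected → x ∈ T.verts → ∀ w ∈ p.support, w ∈ T.verts →
      b ∈ T.edgeSet := by
  classical
  induction b with | h y z =>
  obtain ⟨e, he⟩ : ∃ e, e ∈ p.edges :=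
    List.exists_mem_of_ne_nil _ fun h => by
      exact hp.not_nil (by simpa using h)
  have hne : s(y, z) ≠ e := by rintro rfl; exact hbp he
  have hbridge : ¬ (G.deleteEdges {s(y, z)}).Reachable y z := by
    intro hr
    have hbr : ¬ (G.deleteEdges {s(y, z)}).IsBridge e := by
      intro h
      refine h.notMem_edges_of_isCycle
        (p := p.toDeleteEdges {s(y, z)} (by rintro e he rfl; exact hbp he)) ?_ ?_
      · exact hp.toDeleteEdges _ _ _
      · simpa using he
    have hconn : (G.deleteEdges {s(y, z)}).Connected :=
      hG.connected_delete_edge_of_not_isBridge (by simpa [isBridge_iff] using hr)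
    refine not_reachable_of_mem_cycle hG huni hp hb he hne ?_
    rw [deleteEdges_deleteEdges, Set.union_comm, ← deleteEdges_deleteEdges]
    induction e with | h a c =>
    exact (hconn.connected_delete_edge_of_not_isBridge hbr).preconnected y z
  have hcyc : ∀ w ∈ p.support, (G.deleteEdges {s(y, z)}).Reachable u w := by
    intro w hw
    exact ⟨(p.takeUntil w hw).toDeleteEdges _ (by
      rintro e he rfl; exact hbp (p.edges_takeUntil_subset_edges hw he))⟩
  obtain ⟨x, hx⟩ : ∃ x, ¬ (G.deleteEdges {s(y, z)}).Reachable u x := by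
    by_contra! hall
    exact hbridge ((hall y).symm.trans (hall z))
  refine ⟨x, fun T hT hxT w hw hwT => by_contra fun hbT => hx ?_⟩
  refine (Subgraph.Connected.iff_of_forall_adj hT
    (P := fun x => (G.deleteEdges {s(y, z)}).Reachable u x) ?_ hwT hxT).1 (hcyc w hw)
  intro a c hac
  have : (G.deleteEdges {s(y, z)}).Adj a c := by
    rw [deleteEdges_adj]
    refine ⟨hac.adj_sub, fun h => hbT ?_⟩
    rw [← Set.mem_singleton_iff.1 h]
    exact hac
  exact ⟨fun h => h.trans this.reachable, fun h => h.trans this.symm.reachable⟩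

/-- Vertices in one component of `G - R` lie on a common subtree of `G` avoiding `R`. -/
lemma exists_subtree_avoiding (R : Set (Sym2 V)) (w : V) :
    ∃ T : G.Subgraph, {x | (G.deleteEdges R).Reachable w x} ⊆ T.verts ∧ T.coe.IsTree ∧
      ∀ e ∈ T.edgeSet, e ∉ R := by
  obtain ⟨F, hF, hFt⟩ :=
    ((G.deleteEdges R).connectedComponentMk w).maximal_connected_induce_supp.prop.exists_isTree_le
  refine ⟨{ verts := ((G.deleteEdges R).connectedComponentMk w).supp
            Adj := fun x y => ∃ hx hy, F.Adj ⟨x, hx⟩ ⟨y, hy⟩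
            adj_sub := ?_
            edge_vert := fun ⟨hx, _⟩ => hx
            symm := ⟨fun x y ⟨hx, hy, h⟩ => ⟨hy, hx, h.symm⟩⟩ }, ?_, ?_, ?_⟩
  · rintro x y ⟨hx, hy, h⟩
    exact deleteEdges_le _ (hF h)
  · intro x hx
    exact (ConnectedComponent.eq.2 hx).symm
  · convert hFt using 1
    ext ⟨x, hx⟩ ⟨y, hy⟩
    exact ⟨fun ⟨_, _, h⟩ => h, fun h => ⟨hx, hy, h⟩⟩
  · intro e
    induction e with | h x y =>
    rintro ⟨hx, hy, h⟩
    exact ((deleteEdges_adj ..).1 (hF h)).2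

end SimpleGraph

/-- A finite set `E` admits a coloring by `|E| - 2` colors whose only coincidences are
`a ∼ a'` and `b ∼ b'`. -/
lemma exists_coloring_two_coincidences {α : Type*} {E : Set α} {n : ℕ} (hE : E.ncard = n)
    (hn : 3 ≤ n) {a b a' b' : α} (ha : a ∈ E) (hb : b ∈ E) (ha' : a' ∈ E) (hb' : b' ∈ E)
    (h : [a, b, a', b'].Nodup) :
    ∃ c : α → Fin (n - 2), ∀ D ⊆ E, ¬ (a ∈ D ∧ a' ∈ D) → ¬ (b ∈ D ∧ b' ∈ D) →
      Set.InjOn c D := by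
  classical
  have hfin : E.Finite := Set.finite_of_ncard_pos (by omega)
  have hcard : (E \ {a', b'}).ncard = n - 2 := by
    rw [Set.ncard_sdiff (by rintro x (rfl | rfl) <;> assumption), Set.ncard_pair (by grind), hE]
  have : Finite ↥(E \ {a', b'}) := hfin.sdiff
  have : NeZero (n - 2) := ⟨by omega⟩
  let φ : ↥(E \ {a', b'}) ≃ Fin (n - 2) := (Finite.equivFin _).trans (finCongr hcard)
  let ψ : α → Fin (n - 2) := fun x => if hx : x ∈ E \ {a', b'} then φ ⟨x, hx⟩ else 0
  have hψ : Set.InjOn ψ (E \ {a', b'}) := by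
    intro x hx y hy hxy
    simp only [ψ, dif_pos hx, dif_pos hy] at hxy
    simpa using hxy
  let r : α → α := fun x => if x = a' then a else if x = b' then b else x
  refine ⟨fun x => ψ (r x), fun D hD h₁ h₂ x hx y hy hxy => ?_⟩
  have hr : ∀ x ∈ D, r x ∈ E \ {a', b'} := by
    intro x hx
    have := hD hx
    simp only [r, Set.mem_sdiff, Set.mem_insert_iff, Set.mem_singleton_iff]
    grind
  have := hψ (hr x hx) (hr y hy) hxy
  simp only [r] at this
  grind

/-- A set with at least three more elements than colors contains such a set of size at most six
in which no color is unique. -/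
lemma Finset.exists_small_subset_of_card_image_add_three_le {α β : Type*} [DecidableEq α]
    [DecidableEq β] (c : α → β) (E : Finset α) (h : (E.image c).card + 3 ≤ E.card) :
    ∃ F ⊆ E, F.card ≤ 6 ∧ (F.image c).card + 3 ≤ F.card ∧
      ∀ e ∈ F, ∃ e' ∈ F, e' ≠ e ∧ c e' = c e := by
  obtain ⟨R, hRE, hinj, himg⟩ := Finset.exists_subset_injOn_image_eq_of_surjOn (f := c) (E : Set α)
    (E.image c) (by intro y hy; simpa using hy)
  have hRE' : R ⊆ E := by exact_mod_cast hRE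
  have hRc : R.card = (E.image c).card := by rw [← himg, Finset.card_image_of_injOn hinj]
  obtain ⟨U, hU, hU3⟩ := Finset.exists_subset_card_eq (s := E \ R) (n := 3) (by
    rw [Finset.card_sdiff_of_subset hRE']; omega)
  have hrep : ∀ u ∈ U, ∃ r ∈ R, c r = c u := by
    intro u hu
    have : c u ∈ R.image c := himg ▸ Finset.mem_image_of_mem c (Finset.mem_sdiff.1 (hU hu)).1
    simpa using this
  have hR'img : (R.filter fun r => c r ∈ U.image c).image c = U.image c := by
    ext y
    simp only [Finset.mem_image, Finset.mem_filter]
    constructor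
    · rintro ⟨r, ⟨-, u, hu, hur⟩, rfl⟩
      exact ⟨u, hu, hur⟩
    · rintro ⟨u, hu, rfl⟩
      obtain ⟨r, hr, hru⟩ := hrep u hu
      exact ⟨r, ⟨hr, u, hu, hru.symm⟩, hru⟩
  have hR'card : (R.filter fun r => c r ∈ U.image c).card = (U.image c).card := by
    rw [← Finset.card_image_of_injOn (hinj.mono (Finset.coe_subset.2 (Finset.filter_subset _ R))),
      hR'img]
  have hdisj : Disjoint U (R.filter fun r => c r ∈ U.image c) := by
    rw [Finset.disjoint_left]
    intro u hu hu'
    exact (Finset.mem_sdiff.1 (hU hu)).2 (Finset.mem_filter.1 hu').1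
  have hUc : (U.image c).card ≤ 3 := hU3 ▸ Finset.card_image_le
  refine ⟨U ∪ R.filter fun r => c r ∈ U.image c, ?_, ?_, ?_, ?_⟩
  · exact Finset.union_subset (hU.trans Finset.sdiff_subset)
      ((Finset.filter_subset _ _).trans hRE')
  · rw [Finset.card_union_of_disjoint hdisj]; omega
  · rw [Finset.card_union_of_disjoint hdisj, Finset.image_union, hR'img, Finset.union_self]; omega
  · intro e he
    rcases Finset.mem_union.1 he with he | he
    · obtain ⟨r, hr, hru⟩ := hrep e he
      refine ⟨r, Finset.mem_union_right _ (Finset.mem_filter.2 ⟨hr, ?_⟩), ?_, hru⟩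
      · exact hru ▸ Finset.mem_image_of_mem c he
      · rintro rfl
        exact (Finset.mem_sdiff.1 (hU he)).2 hr
    · obtain ⟨u, hu, hur⟩ := Finset.mem_image.1 (Finset.mem_filter.1 he).2
      refine ⟨u, Finset.mem_union_left _ hu, ?_, hur⟩
      rintro rfl
      exact Finset.disjoint_left.1 hdisj hu he

/-- A final segment of `[0, m)` containing at most two elements of `I`, and as many as possible. -/
lemma exists_final_segment (I : Finset ℕ) (m : ℕ) :
    ∃ t ≤ m - 1, (I.filter fun k => t ≤ k ∧ k < m).card ≤ 2 ∧
      (I.filter fun k => k < t).card ≤ (I.filter fun k => k < m).card - 2 := by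
  have hex : ∃ t, (I.filter fun k => t ≤ k ∧ k < m).card ≤ 2 :=
    ⟨m, by rw [Finset.filter_false_of_mem (by intros; omega)]; simp⟩
  classical
  refine ⟨Nat.find hex, Nat.find_min' hex ?_, Nat.find_spec hex, ?_⟩
  · refine (Finset.card_le_card (t := {m - 1}) ?_).trans (by simp)
    intro k hk
    simp only [Finset.mem_filter, Finset.mem_singleton] at *
    omega
  · generalize ht : Nat.find hex = t
    rcases t with _ | t
    · simp
    have h1 : 3 ≤ (I.filter fun k => t ≤ k ∧ k < m).card := by
      by_contra hlt
      have := Nat.find_min' hex (m := t) (by omega)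
      omega
    have h2 : (I.filter fun k => t ≤ k ∧ k < m).card ≤
        (I.filter fun k => t + 1 ≤ k ∧ k < m).card + 1 := by
      refine (Finset.card_le_card (t := insert t (I.filter fun k => t + 1 ≤ k ∧ k < m)) ?_).trans
        (Finset.card_insert_le _ _)
      intro k hk
      simp only [Finset.mem_filter, Finset.mem_insert] at *
      by_cases k = t
      · left; assumption
      · right; refine ⟨hk.1, ?_⟩; omega
    have h3 : (I.filter fun k => k < t + 1).card + (I.filter fun k => t + 1 ≤ k ∧ k < m).card ≤
        (I.filter fun k => k < m).card := by
      rw [← Finset.card_union_of_disjoint]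
      · refine Finset.card_le_card fun k hk => ?_
        have htm : t < m := by
          by_contra hlt
          rw [Finset.filter_false_of_mem (by intros; omega)] at h1
          simp at h1
        simp only [Finset.mem_filter, Finset.mem_union] at *
        rcases hk with hk | hk
        · exact ⟨hk.1, by omega⟩
        · exact ⟨hk.1, hk.2.2⟩
      · rw [Finset.disjoint_filter]
        intros; omega
    omega

/-- At most six indices below `g` are cut into three intervals with at most two in each. -/
lemma exists_two_cuts (I : Finset ℕ) {g : ℕ} (hg : 0 < g) (hI : I.card ≤ 6) :
    ∃ s t, s < g ∧ t < g ∧ s ≤ t ∧ (I.filter fun k => k < s).card ≤ 2 ∧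
      (I.filter fun k => s ≤ k ∧ k < t).card ≤ 2 ∧
      (I.filter fun k => t ≤ k ∧ k < g).card ≤ 2 := by
  obtain ⟨t, ht, h1, h2⟩ := exists_final_segment I g
  obtain ⟨s, hs, h3, h4⟩ := exists_final_segment I t
  have := Finset.card_filter_le I fun k => k < g
  exact ⟨s, t, by omega, by omega, by omega, by omega, h3, h1⟩

namespace SimpleGraph

variable {V : Type*} {G : SimpleGraph V}

/-- A unicyclic graph with cycle length at least four has a `3`-rainbow coloring with `n - 2`
colors. -/
lemma IsCycleLabelling.exists_isRainbowColoring [Fintype V] {C : Set (Sym2 V)} {g : ℕ}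
    {v : ℕ → V} {ρ : V → ℕ} (h : IsCycleLabelling G C g v ρ) (hg : 4 ≤ g)
    (hn : 3 ≤ Fintype.card V) (huni : G.edgeSet.ncard = Fintype.card V) :
    ∃ c : Sym2 V → Fin (Fintype.card V - 2), IsRainbowColoring G c 3 := by
  classical
  set ε : ℕ → Sym2 V := fun k => s(v k, v (k + 1)) with hε
  have hεG : ∀ k < g, ε k ∈ G.edgeSet := h.adj
  have hεC : ∀ k < g, ε k ∈ C := fun k hk => (h.mem_iff _).2 ⟨k, hk, rfl⟩
  have hεne : ∀ i j, i < g → j < g → i ≠ j → ε i ≠ ε j :=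
    fun i j hi hj hij he => hij (h.edge_injOn (by omega) hi hj he)
  obtain ⟨c, hc⟩ := exists_coloring_two_coincidences huni hn
    (hεG 0 (by omega)) (hεG 1 (by omega)) (hεG 2 (by omega)) (hεG 3 (by omega))
    (by
      have h01 := hεne 0 1 (by omega) (by omega) (by omega)
      have h02 := hεne 0 2 (by omega) (by omega) (by omega)
      have h03 := hεne 0 3 (by omega) (by omega) (by omega)
      have h12 := hεne 1 2 (by omega) (by omega) (by omega)
      have h13 := hεne 1 3 (by omega) (by omega) (by omega)
      have h23 := hεne 2 3 (by omega) (by omega) (by omega)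
      simp [h01, h02, h03, h12, h13, h23])
  refine ⟨c, fun S hS => ?_⟩
  -- it suffices to delete one edge of each repeated color without separating `S`
  have key : ∀ i j, i < g → j < g → (i = 0 ∨ i = 2) → (j = 1 ∨ j = 3) → ∀ w,
      (∀ x ∈ S, (G.deleteEdges {ε i, ε j}).Reachable w (v (ρ x))) →
      ∃ T : G.Subgraph, (↑S : Set V) ⊆ T.verts ∧ T.coe.IsTree ∧ Set.InjOn c T.edgeSet := by
    intro i j hi hj hi' hj' w hw
    obtain ⟨T, hT, hTt, hTR⟩ := exists_subtree_avoiding (G := G) {ε i, ε j} w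
    refine ⟨T, fun x hx => hT ((hw x hx).trans ?_), hTt, hc _ T.edgeSet_subset ?_ ?_⟩
    · refine ((h.reachable x).mono (deleteEdges_anti ?_)).symm
      rintro e (rfl | rfl)
      exacts [hεC i hi, hεC j hj]
    · rintro ⟨h0, h2⟩
      rcases hi' with rfl | rfl
      exacts [hTR _ h0 (by simp), hTR _ h2 (by simp)]
    · rintro ⟨h0, h2⟩
      rcases hj' with rfl | rfl
      exacts [hTR _ h0 (by simp), hTR _ h2 (by simp)]
  have arc : ∀ i j a b, i < g → j < g → a ≤ b → b ≤ g → (i < a ∨ b ≤ i) → (j < a ∨ b ≤ j) →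
      (G.deleteEdges {ε i, ε j}).Reachable (v a) (v b) := by
    intro i j a b hi hj hab hb hia hja
    refine reachable_of_forall_adj hab fun k h1 h2 => ?_
    rw [deleteEdges_adj]
    refine ⟨h.adj k (by omega), ?_⟩
    rintro (he | he)
    exacts [hεne k i (by omega) hi (by omega) he, hεne k j (by omega) hj (by omega) he]
  obtain ⟨l, hl, hlS⟩ : ∃ l < 4, ∀ x ∈ S, (if ρ x < 4 then ρ x else 0) ≠ l := by
    by_contra! hall
    have : Finset.range 4 ⊆ S.image fun x => if ρ x < 4 then ρ x else 0 := by
      intro l hl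
      obtain ⟨x, hx, hxl⟩ := hall l (Finset.mem_range.1 hl)
      exact Finset.mem_image.2 ⟨x, hx, hxl⟩
    have := (Finset.card_le_card this).trans Finset.card_image_le
    simp [hS] at this
  have hlt := h.lt
  interval_cases l
  · refine key 0 3 (by omega) (by omega) (by omega) (by omega) (v 1) fun x hx => ?_
    have := hlS x hx
    refine arc _ _ _ _ (by omega) (by omega) ?_ ?_ ?_ ?_ <;> split_ifs at this <;> omega
  · refine key 0 1 (by omega) (by omega) (by omega) (by omega) (v 2) fun x hx => ?_
    have := hlS x hx
    have := hlt x
    by_cases h0 : ρ x = 0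
    · rw [h0, ← h.closed]
      refine arc _ _ _ _ (by omega) (by omega) ?_ ?_ ?_ ?_ <;> omega
    · refine arc _ _ _ _ (by omega) (by omega) ?_ ?_ ?_ ?_ <;> grind
  · refine key 2 1 (by omega) (by omega) (by omega) (by omega) (v 0) fun x hx => ?_
    have := hlS x hx
    have := hlt x
    by_cases h0 : ρ x < 2
    · refine arc _ _ _ _ (by omega) (by omega) ?_ ?_ ?_ ?_ <;> omega
    · rw [← h.closed]
      refine (arc _ _ _ _ (by omega) (by omega) ?_ ?_ ?_ ?_).symm <;> grind
  · refine key 2 3 (by omega) (by omega) (by omega) (by omega) (v 0) fun x hx => ?_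
    have := hlS x hx
    have := hlt x
    by_cases h0 : ρ x < 3
    · refine arc _ _ _ _ (by omega) (by omega) ?_ ?_ ?_ ?_ <;> omega
    · rw [← h.closed]
      refine (arc _ _ _ _ (by omega) (by omega) ?_ ?_ ?_ ?_).symm <;> grind

/-- Given a set `F` of at most six edges and a vertex `x` in the branch of `v 0`, there are two
cycle vertices such that a connected subgraph through these and `x` misses at most two cycle edges
of `F`. -/
lemma IsCycleLabelling.exists_vertices_card_missing_le {C : Set (Sym2 V)} {g : ℕ} {v : ℕ → V}
    {ρ : V → ℕ} [DecidableEq (Sym2 V)] (h : IsCycleLabelling G C g v ρ) (hg : 3 ≤ g) {x : V}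
    (hx : ρ x = 0) (F : Finset (Sym2 V)) (hF : F.card ≤ 6) :
    ∃ s t, s < g ∧ t < g ∧ ∀ T : G.Subgraph, T.coe.Connected → x ∈ T.verts → v s ∈ T.verts →
      v t ∈ T.verts → ∀ O ⊆ F, (∀ e ∈ O, e ∈ C ∧ e ∉ T.edgeSet) → O.card ≤ 2 := by
  set ε : ℕ → Sym2 V := fun k => s(v k, v (k + 1)) with hε
  have hinj : ∀ A : Finset (Sym2 V), Set.InjOn ε ↑((Finset.range g).filter fun k => ε k ∈ A) := by
    intro A i hi j hj hij
    simp only [Finset.coe_filter, Finset.mem_range, Set.mem_ofPred_eq] at hi hj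
    exact h.edge_injOn hg hi.1 hj.1 hij
  obtain ⟨s, t, hs, ht, hst, h1, h2, h3⟩ := exists_two_cuts
    ((Finset.range g).filter fun k => ε k ∈ F) (g := g) (by omega) (by
      refine le_trans ?_ hF
      refine Finset.card_le_card_of_injOn ε (fun k hk => ?_) (hinj F)
      exact (Finset.mem_filter.1 hk).2)
  refine ⟨s, t, hs, ht, fun T hT hxT hsT htT O hOF hO => ?_⟩
  have hOcard : O.card ≤ ((Finset.range g).filter fun k => ε k ∈ O).card := by
    refine Finset.card_le_card_of_surjOn ε fun e he => ?_
    obtain ⟨k, hk, rfl⟩ := (h.mem_iff e).1 (hO e he).1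
    exact ⟨k, by simpa using ⟨hk, he⟩, rfl⟩
  have hcut : ∀ i j, i < j → j < g → ε i ∈ O → ε j ∈ O → ¬ (i < s ∧ s ≤ j) ∧ ¬ (i < t ∧ t ≤ j) := by
    intro i j hij hj hiO hjO
    have hs' := h.mem_Ioc_iff hT hij hj (hO _ hiO).2 (hO _ hjO).2 hxT hsT
    have ht' := h.mem_Ioc_iff hT hij hj (hO _ hiO).2 (hO _ hjO).2 hxT htT
    rw [hx, h.label s hs] at hs'
    rw [hx, h.label t ht] at ht'
    omega
  rcases ((Finset.range g).filter fun k => ε k ∈ O).eq_empty_or_nonempty with hemp | ⟨i, hi⟩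
  · rw [hemp] at hOcard
    simp at hOcard
    simp [hOcard]
  refine hOcard.trans ?_
  have hi' := Finset.mem_filter.1 hi
  have hig := Finset.mem_range.1 hi'.1
  have hsame : ∀ k ∈ (Finset.range g).filter fun k => ε k ∈ O,
      k ∈ (Finset.range g).filter (fun k => ε k ∈ F) ∧ k < g ∧ (i < s ↔ k < s) ∧ (i < t ↔ k < t) := by
    intro k hk
    have hk' := Finset.mem_filter.1 hk
    have hkg := Finset.mem_range.1 hk'.1
    refine ⟨Finset.mem_filter.2 ⟨hk'.1, hOF hk'.2⟩, hkg, ?_⟩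
    rcases lt_trichotomy i k with hik | rfl | hik
    · have := hcut i k hik hkg hi'.2 hk'.2
      omega
    · simp
    · have := hcut k i hik hig hk'.2 hi'.2
      omega
  by_cases his : i < s
  · refine (Finset.card_le_card fun k hk => ?_).trans h1
    obtain ⟨hkF, hkg, hks, hkt⟩ := hsame k hk
    exact Finset.mem_filter.2 ⟨hkF, by omega⟩
  by_cases hit : i < t
  · refine (Finset.card_le_card fun k hk => ?_).trans h2
    obtain ⟨hkF, hkg, hks, hkt⟩ := hsame k hk
    exact Finset.mem_filter.2 ⟨hkF, by omega⟩
  · refine (Finset.card_le_card fun k hk => ?_).trans h3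
    obtain ⟨hkF, hkg, hks, hkt⟩ := hsame k hk
    exact Finset.mem_filter.2 ⟨hkF, by omega⟩

section LowerBound

variable [Fintype V] {α : Type*} {c : Sym2 V → α}

/-- In a `3`-rainbow coloring any three, possibly equal, vertices lie on a rainbow tree. -/
lemma _root_.IsRainbowColoring.exists_subtree (hc : IsRainbowColoring G c 3)
    (hn : 3 ≤ Fintype.card V) (x y z : V) :
    ∃ T : G.Subgraph, x ∈ T.verts ∧ y ∈ T.verts ∧ z ∈ T.verts ∧ T.coe.Connected ∧
      Set.InjOn c T.edgeSet := by
  classical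
  obtain ⟨S, hS, hS3⟩ := Finset.exists_superset_card_eq (s := {x, y, z}) Finset.card_le_three hn
  obtain ⟨T, hT, hTt, hTc⟩ := hc S hS3
  exact ⟨T, hT (hS (by simp)), hT (hS (by simp)), hT (hS (by simp)), hTt.connected, hTc⟩

variable {u : V} {p : G.Walk u u}

/-- Distinct noncycle edges receive distinct colors. -/
lemma _root_.IsRainbowColoring.injOn_noncycle (hc : IsRainbowColoring G c 3)
    (hn : 3 ≤ Fintype.card V) (hG : G.Connected) (huni : G.edgeSet.ncard = Fintype.card V)
    (hp : p.IsCycle) {b b' : Sym2 V} (hb : b ∈ G.edgeSet) (hbp : b ∉ p.edges)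
    (hb' : b' ∈ G.edgeSet) (hbp' : b' ∉ p.edges) (h : c b = c b') : b = b' := by
  obtain ⟨x, hx⟩ := exists_forced_vertex hG huni hp hb hbp
  obtain ⟨x', hx'⟩ := exists_forced_vertex hG huni hp hb' hbp'
  obtain ⟨T, hxT, hxT', huT, hTc, hTi⟩ := hc.exists_subtree hn x x' u
  exact hTi (hx T hTc hxT u p.start_mem_support huT) (hx' T hTc hxT' u p.start_mem_support huT) h

/-- At most one cycle edge shares its color with a noncycle edge. -/
lemma _root_.IsRainbowColoring.eq_of_shared (hc : IsRainbowColoring G c 3)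
    (hn : 3 ≤ Fintype.card V) (hG : G.Connected) (huni : G.edgeSet.ncard = Fintype.card V)
    (hp : p.IsCycle) {b b' e e' : Sym2 V} (hb : b ∈ G.edgeSet) (hbp : b ∉ p.edges)
    (hb' : b' ∈ G.edgeSet) (hbp' : b' ∉ p.edges) (he : e ∈ p.edges) (he' : e' ∈ p.edges)
    (h : c e = c b) (h' : c e' = c b') : e = e' := by
  obtain ⟨x, hx⟩ := exists_forced_vertex hG huni hp hb hbp
  obtain ⟨x', hx'⟩ := exists_forced_vertex hG huni hp hb' hbp'
  obtain ⟨v, ρ, hv, -⟩ := exists_isCycleLabelling hG huni hp u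
  have hmem : ∀ k < p.length, v k ∈ p.support := fun k hk =>
    p.fst_mem_support_of_mem_edges ((hv.mem_iff _).2 ⟨k, hk, rfl⟩)
  have aux : ∀ i j, i < j → j < p.length →
      ¬ ∀ T : G.Subgraph, T.coe.Connected → Set.InjOn c T.edgeSet → b ∈ T.edgeSet →
        b' ∈ T.edgeSet → s(v i, v (i + 1)) ∉ T.edgeSet ∧ s(v j, v (j + 1)) ∉ T.edgeSet := by
    intro i j hij hj hall
    obtain ⟨k, hk, hkx⟩ : ∃ k < p.length, ¬ ((i < ρ x ∧ ρ x ≤ j) ↔ (i < k ∧ k ≤ j)) := by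
      by_cases hx : i < ρ x ∧ ρ x ≤ j
      · exact ⟨i, by omega, by omega⟩
      · exact ⟨j, hj, by omega⟩
    obtain ⟨T, hxT, hxT', hkT, hTc, hTi⟩ := hc.exists_subtree hn x x' (v k)
    obtain ⟨h1, h2⟩ := hall T hTc hTi (hx T hTc hxT _ (hmem k hk) hkT)
      (hx' T hTc hxT' _ (hmem k hk) hkT)
    have := hv.mem_Ioc_iff hTc hij hj h1 h2 hxT hkT
    rw [hv.label k hk] at this
    exact hkx this
  have hmiss : ∀ T : G.Subgraph, Set.InjOn c T.edgeSet → b ∈ T.edgeSet → b' ∈ T.edgeSet →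
      e ∉ T.edgeSet ∧ e' ∉ T.edgeSet := by
    refine fun T hTi hbT hbT' => ⟨fun heT => ?_, fun heT => ?_⟩
    · exact hbp (hTi heT hbT h ▸ he)
    · exact hbp' (hTi heT hbT' h' ▸ he')
  obtain ⟨i, hi, hie⟩ := (hv.mem_iff e).1 he
  obtain ⟨j, hj, hje⟩ := (hv.mem_iff e').1 he'
  subst hie hje
  rcases lt_trichotomy i j with hij | rfl | hij
  · exact (aux i j hij hj fun T _ h1 h2 h3 => hmiss T h1 h2 h3).elim
  · rfl
  · exact (aux j i hij hi fun T _ h1 h2 h3 => (hmiss T h1 h2 h3).symm).elim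

/-- A `3`-rainbow coloring of a unicyclic graph uses at least `n - 2` colors. -/
lemma _root_.IsRainbowColoring.card_le {q : ℕ} {c : Sym2 V → Fin q}
    (hc : IsRainbowColoring G c 3) (hn : 3 ≤ Fintype.card V) (hG : G.Connected)
    (huni : G.edgeSet.ncard = Fintype.card V) (hp : p.IsCycle) :
    Fintype.card V - 2 ≤ q := by
  classical
  by_contra! hq
  have hEcard : G.edgeFinset.card = Fintype.card V := by
    rw [← huni, ← coe_edgeFinset, Set.ncard_coe_finset]
  have hle : (G.edgeFinset.image c).card ≤ q := (Finset.card_le_univ _).trans (by simp)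
  obtain ⟨F, hFE, hF6, hF3, hpart⟩ :=
    Finset.exists_small_subset_of_card_image_add_three_le c G.edgeFinset (by omega)
  have hFG : ∀ e ∈ F, e ∈ G.edgeSet := fun e he => mem_edgeFinset.1 (hFE he)
  have hshare : ∀ b ∈ F, b ∉ p.edges → ∃ e ∈ p.edges, c e = c b := by
    intro b hb hbp
    obtain ⟨e, he, hne, hce⟩ := hpart b hb
    exact ⟨e, by_contra fun hep =>
      hne (hc.injOn_noncycle hn hG huni hp (hFG e he) hep (hFG b hb) hbp hce), hce⟩
  have hsub : ∀ b ∈ F, b ∉ p.edges → ∀ b' ∈ F, b' ∉ p.edges → b = b' := by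
    intro b hb hbp b' hb' hbp'
    obtain ⟨e, he, hce⟩ := hshare b hb hbp
    obtain ⟨e', he', hce'⟩ := hshare b' hb' hbp'
    obtain rfl := hc.eq_of_shared hn hG huni hp (hFG b hb) hbp (hFG b' hb') hbp' he he' hce hce'
    exact hc.injOn_noncycle hn hG huni hp (hFG b hb) hbp (hFG b' hb') hbp' (hce.symm.trans hce')
  obtain ⟨x, hx⟩ : ∃ x, ∀ T : G.Subgraph, T.coe.Connected → x ∈ T.verts → ∀ w ∈ p.support,
      w ∈ T.verts → ∀ b ∈ F, b ∉ p.edges → b ∈ T.edgeSet := by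
    by_cases hb : ∃ b ∈ F, b ∉ p.edges
    · obtain ⟨b, hb, hbp⟩ := hb
      obtain ⟨x, hx⟩ := exists_forced_vertex hG huni hp (hFG b hb) hbp
      exact ⟨x, fun T hT hxT w hw hwT b' hb' hbp' =>
        hsub b hb hbp b' hb' hbp' ▸ hx T hT hxT w hw hwT⟩
    · push Not at hb
      exact ⟨u, fun T _ _ w _ _ b hbF hbp => (hbp (hb b hbF)).elim⟩
  obtain ⟨v, ρ, hv, hρx⟩ := exists_isCycleLabelling hG huni hp x
  obtain ⟨s, t, hs, ht, hst⟩ :=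
    hv.exists_vertices_card_missing_le hp.three_le_length hρx F hF6
  obtain ⟨T, hxT, hsT, htT, hTc, hTi⟩ := hc.exists_subtree hn x (v s) (v t)
  have hO := hst T hTc hxT hsT htT (F.filter fun e => e ∉ T.edgeSet) (Finset.filter_subset _ _) (by
    intro e he
    obtain ⟨heF, heT⟩ := Finset.mem_filter.1 he
    refine ⟨by_contra fun hep => heT ?_, heT⟩
    exact hx T hTc hxT (v s)
      (p.fst_mem_support_of_mem_edges ((hv.mem_iff _).2 ⟨s, hs, rfl⟩)) hsT e heF hep)
  have hin : (F.filter fun e => e ∈ T.edgeSet).card ≤ (F.image c).card := by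
    refine Finset.card_le_card_of_injOn c (fun e he => ?_) fun e he e' he' h => ?_
    · exact Finset.mem_image_of_mem c (Finset.mem_filter.1 he).1
    · exact hTi (Finset.mem_filter.1 he).2 (Finset.mem_filter.1 he').2 h
  have := Finset.card_filter_add_card_filter_not (s := F) fun e => e ∈ T.edgeSet
  omega

end LowerBound

end SimpleGraph

theorem stmt_2 {V : Type*} [Fintype V] (G : SimpleGraph V) (hG : G.Connected)
    (hn : 3 ≤ Fintype.card V) (huni : G.edgeSet.ncard = Fintype.card V)
    (hg : 4 ≤ G.girth) :
    rxk G 3 = Fintype.card V - 2 := by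
  have hcyc : ¬ G.IsAcyclic := fun h => by simp [girth_eq_zero.2 h] at hg
  obtain ⟨u, p, hp, hgp⟩ := exists_girth_eq_length.2 hcyc
  obtain ⟨v, ρ, hv, -⟩ := exists_isCycleLabelling hG huni hp u
  have hex := hv.exists_isRainbowColoring (hgp ▸ hg) hn huni
  refine le_antisymm (Nat.sInf_le hex) (le_csInf ⟨_, hex⟩ ?_)
  rintro q ⟨c, hc⟩
  exact hc.card_le hn hG huni hp
end

section
/- If $G$ is a unicyclic graph of order $n \geq 3$ whose unique cycle has length 3, then $rx_3(G) = n-1$. -/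
open SimpleGraph

namespace SimpleGraph

variable {V : Type*} {G : SimpleGraph V}

/-- A connected subgraph meeting both sides of an edge cut contains an edge of the cut. -/
lemma Subgraph.exists_mem_edgeSet_of_not_reachable {T : G.Subgraph} (hT : T.coe.Connected)
    {F : Set (Sym2 V)} {u w : V} (hu : u ∈ T.verts) (hw : w ∈ T.verts)
    (h : ¬ (G.deleteEdges F).Reachable u w) : ∃ e ∈ F, e ∈ T.edgeSet := by
  by_contra! hF
  let φ : T.coe →g G.deleteEdges F :=
    { toFun := fun v => v.1
      map_rel' := fun {a b} hab => by
        exact SimpleGraph.deleteEdges_adj.2 ⟨T.adj_sub hab, fun hmem => hF _ hmem hab⟩ }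
  exact h ((hT.preconnected ⟨u, hu⟩ ⟨w, hw⟩).map φ)

variable [Fintype V]

/-- Deleting a non-bridge from a connected graph with as many edges as vertices leaves a tree. -/
lemma Connected.isTree_deleteEdges_of_not_isBridge (hG : G.Connected)
    (huni : G.edgeSet.ncard = Fintype.card V) {u v : V} (huv : G.Adj u v)
    (h : ¬ G.IsBridge s(u, v)) : (G.deleteEdges {s(u, v)}).IsTree := by
  rw [isTree_iff_connected_and_card]
  refine ⟨hG.connected_delete_edge_of_not_isBridge h, ?_⟩
  have hmem : s(u, v) ∈ G.edgeSet := huv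
  rw [Nat.card_coe_set_eq, edgeSet_deleteEdges,
    Set.ncard_sdiff_singleton_add_one hmem (Set.toFinite _), huni, Nat.card_eq_fintype_card]

section Triangle

variable {x y z : V}

/-- In a unicyclic graph, an edge outside the triangle is a bridge. -/
lemma Connected.isBridge_of_triangle (hG : G.Connected)
    (huni : G.edgeSet.ncard = Fintype.card V) (hxy : G.Adj x y) (hxz : G.Adj x z)
    (hyz : G.Adj y z) {u v : V} (huv : G.Adj u v)
    (hf : s(u, v) ∉ ({s(x, y), s(x, z), s(y, z)} : Set (Sym2 V))) : G.IsBridge s(u, v) := by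
  by_contra hb
  have hcl := (hG.isTree_deleteEdges_of_not_isBridge huni huv hb).isAcyclic.cliqueFree le_rfl
  simp only [Set.mem_insert_iff, Set.mem_singleton_iff, not_or] at hf
  classical
  refine hcl {x, y, z} (is3Clique_triple_iff.2 ?_)
  simp only [deleteEdges_adj, Set.mem_singleton_iff]
  exact ⟨⟨hxy, Ne.symm hf.1⟩, ⟨hxz, Ne.symm hf.2.1⟩, ⟨hyz, Ne.symm hf.2.2⟩⟩

/-- In a unicyclic graph, deleting the two triangle edges at `x` separates `x` from the
triangle. -/
lemma Connected.not_reachable_of_triangle (hG : G.Connected)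
    (huni : G.edgeSet.ncard = Fintype.card V) (hxy : G.Adj x y) (hxz : G.Adj x z)
    (hyz : G.Adj y z) : ¬ (G.deleteEdges {s(x, y), s(x, z)}).Reachable x y := by
  intro h
  have hb : ¬ G.IsBridge s(x, y) := by
    rw [isBridge_iff, not_not]
    exact h.mono (deleteEdges_anti (by simp))
  have hz := isAcyclic_iff_forall_adj_isBridge.1
    (hG.isTree_deleteEdges_of_not_isBridge huni hxy hb).isAcyclic (v := x) (w := z) (by
      simp [deleteEdges_adj, hxz, hyz.ne', hxz.ne'])
  rw [isBridge_iff, deleteEdges_deleteEdges, Set.singleton_union] at hz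
  refine hz (h.trans (Adj.reachable ?_))
  simp [deleteEdges_adj, hyz, hxy.ne', hxz.ne', hyz.ne, hyz.ne']

end Triangle

end SimpleGraph

section RainbowIndex

variable {V : Type*} [Fintype V] {G : SimpleGraph V}

lemma IsRainbowColoring.exists_tree {α : Type*} {c : Sym2 V → α}
    (hc : IsRainbowColoring G c 3) (hn : 3 ≤ Fintype.card V) (p q r : V) :
    ∃ T : G.Subgraph, p ∈ T.verts ∧ q ∈ T.verts ∧ r ∈ T.verts ∧ T.coe.Connected ∧
      Set.InjOn c T.edgeSet := by
  classical
  obtain ⟨S, hS, hcard⟩ := Finset.exists_superset_card_eq (s := {p, q, r}) Finset.card_le_three hn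
  obtain ⟨T, hT, htree, hinj⟩ := hc S hcard
  exact ⟨T, hT (hS (by simp)), hT (hS (by simp)), hT (hS (by simp)), htree.connected, hinj⟩

variable {α : Type*} {c : Sym2 V → α} {x y z : V}

/-- For an edge `f` outside the triangle there is a vertex `p` cut off from the triangle by `f`. -/
lemma exists_not_reachable_of_triangle (hG : G.Connected)
    (huni : G.edgeSet.ncard = Fintype.card V) (hxy : G.Adj x y) (hxz : G.Adj x z)
    (hyz : G.Adj y z) {f : Sym2 V} (hfG : f ∈ G.edgeSet)
    (hf : f ∉ ({s(x, y), s(x, z), s(y, z)} : Set (Sym2 V))) :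
    ∃ p, ¬ (G.deleteEdges {f}).Reachable p x ∧ ¬ (G.deleteEdges {f}).Reachable p y := by
  induction f with | _ u v =>
  have hb := hG.isBridge_of_triangle huni hxy hxz hyz hfG hf
  rw [isBridge_iff] at hb
  simp only [Set.mem_insert_iff, Set.mem_singleton_iff, not_or] at hf
  have hr : (G.deleteEdges {s(u, v)}).Reachable x y :=
    Adj.reachable (deleteEdges_adj.2 ⟨hxy, Ne.symm hf.1⟩)
  by_cases hu : (G.deleteEdges {s(u, v)}).Reachable u x
  · have hv : ¬ (G.deleteEdges {s(u, v)}).Reachable v x := fun h => hb (hu.trans h.symm)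
    exact ⟨v, hv, fun h => hv (h.trans hr.symm)⟩
  · exact ⟨u, hu, fun h => hu (h.trans hr.symm)⟩

/-- Any two edges outside the triangle lie in a common rainbow subgraph that also contains
a triangle edge at `x`. -/
lemma IsRainbowColoring.exists_injOn_of_triangle (hc : IsRainbowColoring G c 3)
    (hn : 3 ≤ Fintype.card V) (hG : G.Connected)
    (huni : G.edgeSet.ncard = Fintype.card V) (hxy : G.Adj x y) (hxz : G.Adj x z)
    (hyz : G.Adj y z) {f g : Sym2 V} (hfG : f ∈ G.edgeSet) (hgG : g ∈ G.edgeSet)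
    (hf : f ∉ ({s(x, y), s(x, z), s(y, z)} : Set (Sym2 V)))
    (hg : g ∉ ({s(x, y), s(x, z), s(y, z)} : Set (Sym2 V))) :
    ∃ E : Set (Sym2 V), Set.InjOn c E ∧ f ∈ E ∧ g ∈ E ∧ (s(x, y) ∈ E ∨ s(x, z) ∈ E) := by
  obtain ⟨p, hpx, hpy⟩ := exists_not_reachable_of_triangle hG huni hxy hxz hyz hfG hf
  obtain ⟨q, hqx, hqy⟩ := exists_not_reachable_of_triangle hG huni hxy hxz hyz hgG hg
  have hsep := hG.not_reachable_of_triangle huni hxy hxz hyz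
  obtain ⟨r, hpr, hqr, hrp⟩ : ∃ r, ¬ (G.deleteEdges {f}).Reachable p r ∧
      ¬ (G.deleteEdges {g}).Reachable q r ∧
        ¬ (G.deleteEdges {s(x, y), s(x, z)}).Reachable r p := by
    by_cases hxp : (G.deleteEdges {s(x, y), s(x, z)}).Reachable x p
    · exact ⟨y, hpy, hqy, fun h => hsep (hxp.trans h.symm)⟩
    · exact ⟨x, hpx, hqx, hxp⟩
  obtain ⟨T, hp, hq, hr, hT, hinj⟩ := hc.exists_tree hn p q r
  refine ⟨T.edgeSet, hinj, ?_, ?_, ?_⟩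
  · simpa using T.exists_mem_edgeSet_of_not_reachable hT hp hr hpr
  · simpa using T.exists_mem_edgeSet_of_not_reachable hT hq hr hqr
  · simpa using T.exists_mem_edgeSet_of_not_reachable hT hr hp hrp

/-- The edges outside the triangle have distinct colors. -/
lemma IsRainbowColoring.injOn_diff_triangle (hc : IsRainbowColoring G c 3)
    (hn : 3 ≤ Fintype.card V) (hG : G.Connected)
    (huni : G.edgeSet.ncard = Fintype.card V) (hxy : G.Adj x y) (hxz : G.Adj x z)
    (hyz : G.Adj y z) : Set.InjOn c (G.edgeSet \ {s(x, y), s(x, z), s(y, z)}) := by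
  rintro g ⟨hgG, hg⟩ h ⟨hhG, hh⟩
  obtain ⟨E, hE, hgE, hhE, -⟩ :=
    hc.exists_injOn_of_triangle hn hG huni hxy hxz hyz hgG hhG hg hh
  exact hE hgE hhE

/-- A color shared by `s(y, z)` and an edge outside the triangle forces all other edges to have
distinct colors. -/
lemma IsRainbowColoring.injOn_of_color_eq (hc : IsRainbowColoring G c 3)
    (hn : 3 ≤ Fintype.card V) (hG : G.Connected)
    (huni : G.edgeSet.ncard = Fintype.card V) (hxy : G.Adj x y) (hxz : G.Adj x z)
    (hyz : G.Adj y z) {f : Sym2 V} (hfG : f ∈ G.edgeSet)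
    (hf : f ∉ ({s(x, y), s(x, z), s(y, z)} : Set (Sym2 V))) (hcf : c f = c s(y, z)) :
    Set.InjOn c (G.edgeSet \ {s(y, z)}) := by
  have hyx : s(y, x) = s(x, y) := Sym2.eq_swap
  have hzx : s(z, x) = s(x, z) := Sym2.eq_swap
  have hzy : s(z, y) = s(y, z) := Sym2.eq_swap
  have key : c s(x, y) ≠ c s(x, z) := by
    obtain ⟨p, -, hpy⟩ := exists_not_reachable_of_triangle hG huni hxy hxz hyz hfG hf
    obtain ⟨T, hp, hy, hz, hT, hinj⟩ := hc.exists_tree hn p y z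
    have hfT : f ∈ T.edgeSet := by
      simpa using T.exists_mem_edgeSet_of_not_reachable hT hp hy hpy
    have h₁ := T.exists_mem_edgeSet_of_not_reachable hT hy hz
      (hG.not_reachable_of_triangle huni hyz hxy.symm hxz.symm)
    have h₂ := T.exists_mem_edgeSet_of_not_reachable hT hz hy
      (hG.not_reachable_of_triangle huni hyz.symm hxz.symm hxy.symm)
    have hne : s(x, y) ≠ s(x, z) := by simp [hyz.ne, hxz.ne]
    simp only [Set.mem_insert_iff, Set.mem_singleton_iff, not_or] at hf
    simp only [Set.mem_insert_iff, Set.mem_singleton_iff, exists_eq_or_imp, exists_eq_left,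
      hyx, hzx, hzy] at h₁ h₂
    have hyzT : s(y, z) ∉ T.edgeSet := fun h => hf.2.2 (hinj hfT h hcf)
    exact fun h => hne (hinj (h₁.resolve_left hyzT) (h₂.resolve_left hyzT) h)
  have hBB := hc.injOn_diff_triangle hn hG huni hxy hxz hyz
  have hy : ∀ g ∈ G.edgeSet, g ∉ ({s(x, y), s(x, z), s(y, z)} : Set (Sym2 V)) →
      c g ≠ c s(x, y) := by
    intro g hgG hg
    obtain ⟨E, hE, hgE, hfE, h⟩ := hc.exists_injOn_of_triangle hn hG huni hxy.symm hyz hxz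
      hgG hfG (by grind) (by grind)
    grind [Set.InjOn]
  have hz : ∀ g ∈ G.edgeSet, g ∉ ({s(x, y), s(x, z), s(y, z)} : Set (Sym2 V)) →
      c g ≠ c s(x, z) := by
    intro g hgG hg
    obtain ⟨E, hE, hgE, hfE, h⟩ := hc.exists_injOn_of_triangle hn hG huni hxz.symm hyz.symm hxy
      hgG hfG (by grind) (by grind)
    grind [Set.InjOn]
  rintro g ⟨hgG, hg⟩ h ⟨hhG, hh⟩ hgh
  grind [Set.InjOn]

/-- A rainbow coloring of a unicyclic graph with a triangle has distinct colors on all edges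
but one. -/
lemma IsRainbowColoring.exists_injOn_diff_singleton (hc : IsRainbowColoring G c 3)
    (hn : 3 ≤ Fintype.card V) (hG : G.Connected)
    (huni : G.edgeSet.ncard = Fintype.card V) (hxy : G.Adj x y) (hxz : G.Adj x z)
    (hyz : G.Adj y z) : ∃ e ∈ G.edgeSet, Set.InjOn c (G.edgeSet \ {e}) := by
  have hyx : s(y, x) = s(x, y) := Sym2.eq_swap
  have hzx : s(z, x) = s(x, z) := Sym2.eq_swap
  have hzy : s(z, y) = s(y, z) := Sym2.eq_swap
  by_cases hnew : ∃ f ∈ G.edgeSet, f ∉ ({s(x, y), s(x, z), s(y, z)} : Set (Sym2 V)) ∧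
      (c f = c s(x, y) ∨ c f = c s(x, z) ∨ c f = c s(y, z))
  · obtain ⟨f, hfG, hf, h | h | h⟩ := hnew
    · exact ⟨s(x, y), hxy, hc.injOn_of_color_eq hn hG huni hxz.symm hyz.symm hxy hfG
        (by grind) h⟩
    · exact ⟨s(x, z), hxz, hc.injOn_of_color_eq hn hG huni hxy.symm hyz hxz hfG (by grind) h⟩
    · exact ⟨s(y, z), hyz, hc.injOn_of_color_eq hn hG huni hxy hxz hyz hfG hf h⟩
  push Not at hnew
  have hBB := hc.injOn_diff_triangle hn hG huni hxy hxz hyz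
  have hne₁ : s(x, y) ≠ s(x, z) := by simp [hyz.ne, hxz.ne]
  have hne₂ : s(x, y) ≠ s(y, z) := by simp [hxy.ne, hxz.ne]
  have hne₃ : s(x, z) ≠ s(y, z) := by simp [hxy.ne, hxz.ne]
  have hdist : c s(x, y) ≠ c s(x, z) ∨ c s(x, y) ≠ c s(y, z) ∨ c s(x, z) ≠ c s(y, z) := by
    obtain ⟨T, hx, hy, hz, hT, hinj⟩ := hc.exists_tree hn x y z
    have h₁ := T.exists_mem_edgeSet_of_not_reachable hT hx hy
      (hG.not_reachable_of_triangle huni hxy hxz hyz)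
    have h₂ := T.exists_mem_edgeSet_of_not_reachable hT hy hz
      (hG.not_reachable_of_triangle huni hyz hxy.symm hxz.symm)
    have h₃ := T.exists_mem_edgeSet_of_not_reachable hT hz hy
      (hG.not_reachable_of_triangle huni hyz.symm hxz.symm hxy.symm)
    simp only [Set.mem_insert_iff, Set.mem_singleton_iff, exists_eq_or_imp, exists_eq_left,
      hyx, hzx, hzy] at h₁ h₂ h₃
    have i₁ := fun h h' => mt (hinj (x₁ := s(x, y)) (x₂ := s(x, z)) h h') hne₁
    have i₂ := fun h h' => mt (hinj (x₁ := s(x, y)) (x₂ := s(y, z)) h h') hne₂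
    have i₃ := fun h h' => mt (hinj (x₁ := s(x, z)) (x₂ := s(y, z)) h h') hne₃
    tauto
  rcases hdist with h | h | h
  · exact ⟨s(y, z), hyz, by rintro g ⟨hgG, hg⟩ k ⟨hkG, hk⟩ hgk; grind [Set.InjOn]⟩
  · exact ⟨s(x, z), hxz, by rintro g ⟨hgG, hg⟩ k ⟨hkG, hk⟩ hgk; grind [Set.InjOn]⟩
  · exact ⟨s(x, y), hxy, by rintro g ⟨hgG, hg⟩ k ⟨hkG, hk⟩ hgk; grind [Set.InjOn]⟩

/-- Coloring the edges of a spanning tree with distinct colors gives a rainbow coloring. -/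
lemma exists_isRainbowColoring_card_sub_one (hG : G.Connected) (k : ℕ)
    (hn : 2 ≤ Fintype.card V) :
    ∃ c : Sym2 V → Fin (Fintype.card V - 1), IsRainbowColoring G c k := by
  classical
  obtain ⟨H, hle, hH⟩ := hG.exists_isTree_le
  have hcard : H.edgeFinset.card = Fintype.card V - 1 := by
    have := hH.card_edgeFinset
    omega
  let σ := H.edgeFinset.equivFinOfCardEq hcard
  refine ⟨fun e => if h : e ∈ H.edgeFinset then σ ⟨e, h⟩ else ⟨0, by omega⟩, fun S _ => ?_⟩
  refine ⟨toSubgraph H hle, fun v _ => Set.mem_univ v, ?_, ?_⟩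
  · exact ((toSubgraph H hle).spanningCoeEquivCoeOfSpanning
      (toSubgraph.isSpanning H hle)).isTree_iff.1 hH
  · have hsub : (toSubgraph H hle).edgeSet = H.edgeSet := by
      ext e
      induction e with | _ u v => rfl
    intro e he e' he' h
    rw [hsub, ← mem_edgeFinset] at he he'
    simpa [he, he'] using h

end RainbowIndex

theorem stmt_3 {V : Type*} [Fintype V] (G : SimpleGraph V) (hG : G.Connected)
    (hn : 3 ≤ Fintype.card V) (huni : G.edgeSet.ncard = Fintype.card V)
    (hg : G.girth = 3) :
    rxk G 3 = Fintype.card V - 1 := by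
  have hmem := exists_isRainbowColoring_card_sub_one hG 3 (by omega)
  refine le_antisymm (Nat.sInf_le hmem) (le_csInf ⟨_, hmem⟩ ?_)
  rintro q ⟨c, hc⟩
  have hcyc : ¬ G.IsAcyclic := fun h => by simp [girth_eq_zero.2 h] at hg
  obtain ⟨a, w, hw, hwl⟩ := exists_girth_eq_length.2 hcyc
  obtain ⟨s, hs⟩ := is3Clique_iff_exists_cycle_length_three.2 ⟨a, w, hw, hwl ▸ hg⟩
  classical
  obtain ⟨x, y, z, hxy, hxz, hyz, -⟩ := is3Clique_iff.1 hs
  obtain ⟨e, he, hinj⟩ := hc.exists_injOn_diff_singleton hn hG huni hxy hxz hyz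
  have hle := Set.ncard_le_ncard_of_injOn c (fun _ _ => Set.mem_univ _) hinj Set.finite_univ
  rwa [Set.ncard_sdiff_singleton_of_mem he, huni, Set.ncard_univ, Nat.card_eq_fintype_card,
    Fintype.card_fin] at hle
end

section
/- If $G$ is a unicyclic graph of order $n \geq 3$ with girth $g \geq 3$, then for every integer $k$ with $4 \leq k \leq n$, $rx_k(G) = n-1$. -/
open SimpleGraph

namespace SimpleGraph

variable {V : Type*}

/-- If `u` and `v` are connected in `G` but not after deleting the edge `s(x, y)`, then both are
still connected to an end of that edge. -/
theorem Reachable.deleteEdges_singleton {G : SimpleGraph V} {u v : V} (x y : V)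
    (h : G.Reachable u v) :
    (G.deleteEdges {s(x, y)}).Reachable u v ∨
      (((G.deleteEdges {s(x, y)}).Reachable u x ∨ (G.deleteEdges {s(x, y)}).Reachable u y) ∧
        ((G.deleteEdges {s(x, y)}).Reachable v x ∨
          (G.deleteEdges {s(x, y)}).Reachable v y)) := by
  obtain ⟨p⟩ := h
  induction p with
  | nil => exact .inl .rfl
  | @cons u w v huw p ih =>
    by_cases he : s(u, w) = s(x, y)
    · have hu : (G.deleteEdges {s(x, y)}).Reachable u x ∨
          (G.deleteEdges {s(x, y)}).Reachable u y := by
        rcases Sym2.eq_iff.1 he with ⟨rfl, -⟩ | ⟨rfl, -⟩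
        · exact .inl .rfl
        · exact .inr .rfl
      refine .inr ⟨hu, ?_⟩
      rcases ih with h | ⟨-, h⟩
      · rcases Sym2.eq_iff.1 he with ⟨-, rfl⟩ | ⟨-, rfl⟩
        · exact .inr h.symm
        · exact .inl h.symm
      · exact h
    · have huw' : (G.deleteEdges {s(x, y)}).Reachable u w :=
        Adj.reachable (by simpa [deleteEdges_adj, huw] using he)
      exact ih.imp huw'.trans (And.imp_left (Or.imp huw'.trans huw'.trans))

/-- Deleting an edge creates at most one new connected component. -/
theorem card_connectedComponent_deleteEdges_singleton_le [Finite V] (G : SimpleGraph V)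
    (e : Sym2 V) :
    Nat.card (G.deleteEdges {e}).ConnectedComponent ≤ Nat.card G.ConnectedComponent + 1 := by
  classical
  induction e with | _ x y
  rw [← Finite.card_option]
  let f : (G.deleteEdges {s(x, y)}).ConnectedComponent → Option G.ConnectedComponent := fun C ↦
    if C = connectedComponentMk _ x then none
    else some (C.map (Hom.ofLE (G.deleteEdges_le {s(x, y)})))
  refine Nat.card_le_card_of_injective f fun C D h ↦ ?_
  induction C using ConnectedComponent.ind with | _ u
  induction D using ConnectedComponent.ind with | _ v
  by_cases hu : (G.deleteEdges {s(x, y)}).Reachable u x <;>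
    by_cases hv : (G.deleteEdges {s(x, y)}).Reachable v x <;>
    simp only [f, ConnectedComponent.eq, hu, hv, if_true, if_false, reduceCtorEq,
      Option.some.injEq, ConnectedComponent.map_mk] at h ⊢
  · exact hu.trans hv.symm
  · rcases h.deleteEdges_singleton x y with h | ⟨hu' | hu', hv' | hv'⟩
    · exact h
    · exact absurd hu' hu
    · exact absurd hu' hu
    · exact absurd hv' hv
    · exact hu'.trans hv'.symm

/-- Deleting a set of edges creates at most as many new connected components. -/
theorem card_connectedComponent_deleteEdges_le [Finite V] (G : SimpleGraph V)
    (F : Finset (Sym2 V)) :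
    Nat.card (G.deleteEdges (F : Set (Sym2 V))).ConnectedComponent ≤
      Nat.card G.ConnectedComponent + F.card := by
  classical
  induction F using Finset.induction_on with
  | empty => simp
  | insert e F he ih =>
    have h := (G.deleteEdges (F : Set (Sym2 V))).card_connectedComponent_deleteEdges_singleton_le e
    rw [deleteEdges_deleteEdges, Set.union_comm, ← Set.insert_eq, ← Finset.coe_insert] at h
    rw [Finset.card_insert_of_notMem he]
    omega

/-- A finite graph has at least as many components as it has vertices in excess of its edges. -/
theorem card_le_card_connectedComponent_add_ncard_edgeSet [Finite V] (G : SimpleGraph V) :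
    Nat.card V ≤ Nat.card G.ConnectedComponent + G.edgeSet.ncard := by
  have h := G.card_connectedComponent_deleteEdges_le G.edgeSet.toFinite.toFinset
  rw [Set.Finite.coe_toFinset, ← Set.ncard_eq_toFinset_card] at h
  refine le_trans (Nat.card_le_card_of_injective
    (G.deleteEdges G.edgeSet).connectedComponentMk fun u v huv ↦ ?_) h
  rw [ConnectedComponent.eq, deleteEdges, fromEdgeSet_edgeSet, sdiff_self] at huv
  simpa using huv

/-- If a connected subgraph `T` contains a set of vertices lying in pairwise different components
of `G.deleteEdges F`, then their number exceeds the number of edges of `F` in `T` by at most one. -/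
theorem Subgraph.card_le_ncard_inter_edgeSet_add_one [Finite V] {G : SimpleGraph V}
    {T : G.Subgraph} (hT : T.coe.Connected) (F : Set (Sym2 V)) {S : Finset V}
    (hST : (S : Set V) ⊆ T.verts) (hS : Set.InjOn (G.deleteEdges F).connectedComponentMk S) :
    S.card ≤ (F ∩ T.edgeSet).ncard + 1 := by
  classical
  let E : Set (Sym2 T.verts) := Sym2.map Subtype.val ⁻¹' (F ∩ T.edgeSet)
  have hinj : Function.Injective (Sym2.map (Subtype.val : T.verts → V)) :=
    Sym2.map.injective Subtype.val_injective
  have hE : E.ncard ≤ (F ∩ T.edgeSet).ncard :=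
    Set.ncard_le_ncard_of_injOn _ (fun e he ↦ he) hinj.injOn
  have h := T.coe.card_connectedComponent_deleteEdges_le E.toFinite.toFinset
  rw [Set.Finite.coe_toFinset, ← Set.ncard_eq_toFinset_card] at h
  have hsub := hT.preconnected.subsingleton_connectedComponent
  have hone : Nat.card T.coe.ConnectedComponent ≤ 1 := Finite.card_le_one_iff_subsingleton.2 hsub
  let φ : T.coe.deleteEdges E →g G.deleteEdges F :=
    { toFun := Subtype.val
      map_rel' := by
        rintro ⟨a, ha⟩ ⟨b, hb⟩ hab
        rw [SimpleGraph.deleteEdges_adj] at hab ⊢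
        exact ⟨Subgraph.Adj.adj_sub hab.1, fun hF ↦ hab.2 ⟨hF, hab.1⟩⟩ }
  have hcard : Nat.card S ≤ Nat.card (T.coe.deleteEdges E).ConnectedComponent := by
    refine Nat.card_le_card_of_injective
      (fun s : S ↦ connectedComponentMk _ ⟨s.1, hST s.2⟩) fun s t hst ↦ ?_
    exact Subtype.ext (hS s.2 t.2 (congrArg (ConnectedComponent.map φ) hst))
  rw [Nat.card_eq_fintype_card, Fintype.card_coe] at hcard
  omega

end SimpleGraph

/-- If a map takes at least two values fewer than there are points in its domain, this already
happens on some subset of at most four points. -/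
theorem Finset.exists_subset_card_le_four_card_image_add_two_le {α β : Type*} [DecidableEq α]
    [DecidableEq β] {s : Finset α} {t : Finset β} {c : α → β} (hc : ∀ a ∈ s, c a ∈ t)
    (h : t.card + 2 ≤ s.card) :
    ∃ F ⊆ s, F.card ≤ 4 ∧ (F.image c).card + 2 ≤ F.card := by
  obtain ⟨a, ha, b, hb, hab, hcab⟩ :=
    exists_ne_map_eq_of_card_lt_of_maps_to (by omega : t.card < s.card) hc
  obtain ⟨x, hx, y, hy, hxy, hcxy⟩ :=
    exists_ne_map_eq_of_card_lt_of_maps_to (s := s.erase a) (t := t)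
      (by rw [card_erase_of_mem ha]; omega) (fun z hz ↦ hc z (mem_of_mem_erase hz))
  rw [mem_erase] at hx hy
  by_cases hbxy : b = x ∨ b = y
  · refine ⟨{a, x, y}, by grind, card_le_three.trans (by omega), ?_⟩
    have hcx : c a = c x := by rcases hbxy with rfl | rfl <;> simp [hcab, hcxy]
    simp [image_insert, hcx, ← hcxy, card_insert_of_notMem, hx.1.symm, hy.1.symm, hxy]
  · push Not at hbxy
    refine ⟨{a, b, x, y}, by grind, card_le_four, ?_⟩
    have : ({c b, c y} : Finset β).card ≤ 2 := card_le_two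
    simpa [image_insert, hcab, hcxy, card_insert_of_notMem, hx.1.symm, hy.1.symm, hxy, hab, hbxy]
      using this

/-- A connected graph has a `k`-rainbow coloring that gives different colors to the edges of a
spanning tree. -/
theorem SimpleGraph.Connected.exists_isRainbowColoring {V : Type*} [Fintype V]
    {G : SimpleGraph V} (hG : G.Connected) (hn : 2 ≤ Fintype.card V) (k : ℕ) :
    ∃ c : Sym2 V → Fin (Fintype.card V - 1), IsRainbowColoring G c k := by
  classical
  obtain ⟨T, hTG, hT⟩ := hG.exists_isTree_le
  have hcard := hT.card_edgeFinset
  let e : T.edgeFinset ≃ Fin (Fintype.card V - 1) := T.edgeFinset.equivFinOfCardEq (by omega)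
  let c : Sym2 V → Fin (Fintype.card V - 1) := fun x ↦
    if hx : x ∈ T.edgeFinset then e ⟨x, hx⟩ else ⟨0, by omega⟩
  refine ⟨c, fun S _ ↦ ⟨toSubgraph T hTG, by simp, ?_, ?_⟩⟩
  · let φ : (toSubgraph T hTG).coe ≃g T := ⟨Equiv.Set.univ V, Iff.rfl⟩
    exact φ.isTree_iff.2 hT
  · intro x hx y hy hxy
    have hx' : x ∈ T.edgeFinset := by
      induction x with | _ a b
      simpa using hx
    have hy' : y ∈ T.edgeFinset := by
      induction y with | _ a b
      simpa using hy
    simp only [c, dif_pos hx', dif_pos hy'] at hxy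
    exact congrArg Subtype.val (e.injective hxy)

/-- A `k`-rainbow coloring, `4 ≤ k ≤ n`, of a graph with `n` vertices and `n` edges uses at least
`n - 1` colors. Otherwise some set `F` of at most four edges has at most `#F - 2` colors, while a
tree through representatives of `#F` components of `G - F` contains at least `#F - 1` edges
of `F`. -/
theorem IsRainbowColoring.card_le_s4 {V : Type*} [Fintype V] {G : SimpleGraph V}
    (huni : G.edgeSet.ncard = Fintype.card V) {k : ℕ} (hk : 4 ≤ k) (hkn : k ≤ Fintype.card V)
    {q : ℕ} {c : Sym2 V → Fin q} (hc : IsRainbowColoring G c k) : Fintype.card V - 1 ≤ q := by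
  classical
  by_contra! hq
  rw [Set.ncard_eq_toFinset_card'] at huni
  obtain ⟨F, hFG, hF4, hF⟩ := Finset.exists_subset_card_le_four_card_image_add_two_le
    (s := G.edgeSet.toFinset) (t := Finset.univ) (c := c) (by simp)
    (by rw [huni, Finset.card_fin]; omega)
  have hcomp := (G.deleteEdges (F : Set (Sym2 V))).card_le_card_connectedComponent_add_ncard_edgeSet
  rw [edgeSet_deleteEdges, ← Set.coe_toFinset G.edgeSet, ← Finset.coe_sdiff,
    Set.ncard_coe_finset, Finset.card_sdiff_of_subset hFG, huni, Nat.card_eq_fintype_card,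
    Nat.card_eq_fintype_card] at hcomp
  have hFn := Finset.card_le_card hFG
  obtain ⟨P, hP⟩ := Finset.exists_subset_card_eq
    (s := (Finset.univ : Finset (G.deleteEdges (F : Set (Sym2 V))).ConnectedComponent))
    (n := F.card) (by rw [Finset.card_univ]; omega)
  obtain ⟨r, hmk⟩ : ∃ r : (G.deleteEdges (F : Set (Sym2 V))).ConnectedComponent → V,
      Function.LeftInverse (connectedComponentMk _) r := ⟨Quot.out, Quot.out_eq⟩
  let R : Finset V := P.image r
  have hRinj : Set.InjOn (G.deleteEdges (F : Set (Sym2 V))).connectedComponentMk R := by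
    intro u hu v hv huv
    simp only [R, Finset.coe_image, Set.mem_image] at hu hv
    obtain ⟨C, -, rfl⟩ := hu
    obtain ⟨D, -, rfl⟩ := hv
    rw [hmk, hmk] at huv
    rw [huv]
  have hRcard : R.card = F.card := by
    rw [Finset.card_image_of_injective _ hmk.injective, hP.2]
  obtain ⟨S, hRS, hS⟩ := Finset.exists_superset_card_eq (s := R) (n := k) (by omega) hkn
  obtain ⟨T, hST, hT, hinj⟩ := hc S hS
  have hle := Subgraph.card_le_ncard_inter_edgeSet_add_one hT.connected (F : Set (Sym2 V))
    ((Finset.coe_subset.2 hRS).trans hST) hRinj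
  have himage : ((F : Set (Sym2 V)) ∩ T.edgeSet).ncard ≤ (F.image c).card := by
    rw [← Set.ncard_coe_finset]
    exact Set.ncard_le_ncard_of_injOn c (fun e he ↦ by simpa using ⟨e, he.1, rfl⟩)
      (hinj.mono Set.inter_subset_right)
  omega

theorem stmt_4 {V : Type*} [Fintype V] (G : SimpleGraph V) (hG : G.Connected)
    (hn : 3 ≤ Fintype.card V) (huni : G.edgeSet.ncard = Fintype.card V)
    (hg : 3 ≤ G.girth) (k : ℕ) (hk : 4 ≤ k) (hkn : k ≤ Fintype.card V) :
    rxk G k = Fintype.card V - 1 :=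
  le_antisymm (Nat.sInf_le (hG.exists_isRainbowColoring (by omega) k))
    (le_csInf ⟨_, hG.exists_isRainbowColoring (by omega) k⟩
      fun _ ⟨_, hc⟩ ↦ hc.card_le_s4 huni hk hkn)
end

section
/- If a connected graph $G$ of order $n$ contains a cycle of length $r \geq 4$, then $rx_3(G) \leq n - 2$. -/
open SimpleGraph

/-- A connected subgraph contains a tree on the same vertices. -/
lemma exists_isTree_le_of_connected_coe {V : Type*} {G : SimpleGraph V} (H : G.Subgraph)
    (hH : H.coe.Connected) : ∃ T ≤ H, T.verts = H.verts ∧ T.coe.IsTree := by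
  obtain ⟨F, hle, hF⟩ := hH.exists_isTree_le
  refine ⟨⟨H.verts, fun a b => ∃ ha hb, F.Adj ⟨a, ha⟩ ⟨b, hb⟩, ?_, ?_, ?_⟩, ⟨le_rfl, ?_⟩, rfl, ?_⟩
  · rintro a b ⟨ha, hb, h⟩
    exact H.adj_sub (hle h)
  · rintro a b ⟨ha, hb, h⟩
    exact ha
  · exact ⟨fun a b ⟨ha, hb, h⟩ => ⟨hb, ha, h.symm⟩⟩
  · rintro a b ⟨ha, hb, h⟩
    exact hle h
  · convert hF using 1
    ext a b
    exact ⟨fun ⟨_, _, h⟩ => h, fun h => ⟨a.2, b.2, h⟩⟩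

/-- Four cyclically ordered points can be labelled, together with all other points, by
`card V - 2` labels which are distinct away from any two cyclically consecutive points. -/
lemma exists_labelling_injOn_compl_consecutive {V : Type*} [Fintype V] (x : Fin 4 → V)
    (hx : Function.Injective x) :
    ∃ φ : V → Fin (Fintype.card V - 2), ∀ i, Set.InjOn φ {x (i - 1), x i}ᶜ := by
  classical
  have hcard : ((Finset.univ : Finset V) \ {x 0, x 1}).card = Fintype.card V - 2 := by
    rw [Finset.card_sdiff_of_subset (Finset.subset_univ _), Finset.card_univ,
      Finset.card_pair (hx.ne (by decide))]
  let e := Finset.equivFinOfCardEq hcard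
  have h01 : x 0 ≠ x 1 := hx.ne (by decide)
  have h02 : x 0 ≠ x 2 := hx.ne (by decide)
  have h03 : x 0 ≠ x 3 := hx.ne (by decide)
  have h12 : x 1 ≠ x 2 := hx.ne (by decide)
  have h13 : x 1 ≠ x 3 := hx.ne (by decide)
  have h23 : x 2 ≠ x 3 := hx.ne (by decide)
  let ψ : V → V := fun v => if v = x 0 then x 2 else if v = x 1 then x 3 else v
  have hψ : ∀ v, ψ v ∈ (Finset.univ : Finset V) \ {x 0, x 1} := by
    intro v
    simp only [Finset.mem_sdiff, Finset.mem_univ, true_and, Finset.mem_insert,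
      Finset.mem_singleton, ψ]
    grind
  refine ⟨fun v => e ⟨ψ v, hψ v⟩, fun i v hv w hw h => ?_⟩
  have h' : ψ v = ψ w := congrArg Subtype.val (e.injective h)
  simp only [Set.mem_compl_iff, Set.mem_insert_iff, Set.mem_singleton_iff] at hv hw
  simp only [ψ] at h'
  have hi : (i = 0 ∧ i - 1 = 3) ∨ (i = 1 ∧ i - 1 = 0) ∨ (i = 2 ∧ i - 1 = 1) ∨
      (i = 3 ∧ i - 1 = 2) := by
    clear hv hw
    revert i
    decide
  rcases hi with ⟨h1, h2⟩ | ⟨h1, h2⟩ | ⟨h1, h2⟩ | ⟨h1, h2⟩ <;> rw [h2, h1] at hv hw <;> grind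

/-- Suppose every vertex `v` has a chosen neighbor `f v`, that following `f` leads from every
vertex to one of the four vertices `x i`, the first one met being `x (g v)`, and that after
leaving `x i` the next one met is `x (i + 1)`. Then `card V - 2` colors suffice. -/
lemma exists_isRainbowColoring_of_functional {V : Type*} [Fintype V] (G : SimpleGraph V)
    (x : Fin 4 → V) (f : V → V) (g : V → Fin 4) (d : V → ℕ) (hadj : ∀ v, G.Adj v (f v))
    (hgx : ∀ i, g (x i) = i) (hgf : ∀ i, g (f (x i)) = i + 1)
    (hg : ∀ v, (∀ i, v ≠ x i) → g (f v) = g v) (hd : ∀ v, (∀ i, v ≠ x i) → d (f v) < d v) :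
    ∃ c : Sym2 V → Fin (Fintype.card V - 2), IsRainbowColoring G c 3 := by
  classical
  have hx : Function.Injective x := Function.LeftInverse.injective hgx
  have : Nonempty V := ⟨x 0⟩
  obtain ⟨φ, hφ⟩ := exists_labelling_injOn_compl_consecutive x hx
  have no_two_cycle : ∀ i, f (f (x i)) ≠ x i := by
    intro i h
    have h4 : ∀ i : Fin 4, i + 1 ≠ i ∧ i + 1 + 1 ≠ i := by decide
    by_cases hw : ∀ j, f (x i) ≠ x j
    · have := hg _ hw
      rw [h, hgx, hgf] at this
      exact (h4 i).1 this.symm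
    · push Not at hw
      obtain ⟨j, hj⟩ := hw
      have h1 : j = i + 1 := by rw [← hgx j, ← hj, hgf]
      have h2 := hgf j
      rw [← hj, h, hgx, h1] at h2
      exact (h4 i).2 h2.symm
  have hinj : Function.Injective fun v => s(v, f v) := by
    intro v w hvw
    rcases Sym2.eq_iff.1 hvw with h | ⟨h1, h2⟩
    · exact h.1
    · exfalso
      by_cases hv : ∀ i, v ≠ x i
      · by_cases hw : ∀ i, w ≠ x i
        · have a := hd v hv
          have b := hd w hw
          rw [h2] at a
          rw [← h1] at b
          omega
        · push Not at hw
          obtain ⟨i, rfl⟩ := hw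
          exact no_two_cycle i (by rw [← h1, h2])
      · push Not at hv
        obtain ⟨i, rfl⟩ := hv
        exact no_two_cycle i (by rw [h2, ← h1])
  refine ⟨fun e => φ (Function.invFun (fun v => s(v, f v)) e), fun S hS => ?_⟩
  have hc : ∀ v, Function.invFun (fun v => s(v, f v)) s(v, f v) = v :=
    Function.leftInverse_invFun hinj
  obtain ⟨i, hi⟩ : ∃ i, i ∉ S.image g := by
    by_contra! h
    have h4 : (S.image g).card = 4 := by
      rw [Finset.eq_univ_iff_forall.2 h]; rfl
    have := Finset.card_image_le (s := S) (f := g)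
    omega
  let H : G.Subgraph :=
    { verts := {v | g v ≠ i}
      Adj := fun a b => ∃ v, g v ≠ i ∧ v ≠ x (i - 1) ∧ s(v, f v) = s(a, b)
      adj_sub := by
        rintro a b ⟨v, -, -, h⟩
        rw [← mem_edgeSet, ← h]
        exact hadj v
      edge_vert := by
        rintro a b ⟨v, h1, h2, h⟩
        rcases Sym2.eq_iff.1 h with ⟨rfl, -⟩ | ⟨-, rfl⟩
        · exact h1
        · by_cases hv : ∀ i, v ≠ x i
          · simpa [hg v hv] using h1
          · push Not at hv
            obtain ⟨j, rfl⟩ := hv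
            simp only [Set.mem_ofPred_eq, hgf]
            rintro rfl
            simp at h2
      symm := ⟨fun a b ⟨v, h1, h2, h⟩ => ⟨v, h1, h2, h.trans Sym2.eq_swap⟩⟩ }
  have step : ∀ v, g v ≠ i → v ≠ x (i - 1) → H.Adj v (f v) := fun v h1 h2 => ⟨v, h1, h2, rfl⟩
  have hxm : ∀ j, j ≠ i → x j ∈ H.verts := fun j hj => by simpa [H, hgx] using hj
  have toX : ∀ n v, d v ≤ n → ∀ hv : g v ≠ i,
      H.coe.Reachable ⟨v, hv⟩ ⟨x (g v), hxm _ hv⟩ := by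
    intro n
    induction n with
    | zero =>
      intro v hn hv
      by_cases h : ∀ j, v ≠ x j
      · have := hd v h
        omega
      · push Not at h
        obtain ⟨j, rfl⟩ := h
        simp only [hgx]
        exact Reachable.refl _
    | succ n ih =>
      intro v hn hv
      by_cases h : ∀ j, v ≠ x j
      · have hs := step v hv (h _)
        have h1 := ih (f v) (by have := hd v h; omega) (H.edge_vert hs.symm)
        simp only [hg v h] at h1
        have h2 : H.coe.Adj ⟨v, hv⟩ ⟨f v, H.edge_vert hs.symm⟩ := hs
        exact h2.reachable.trans h1
      · push Not at h
        obtain ⟨j, rfl⟩ := h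
        simp only [hgx]
        exact Reachable.refl _
  have next : ∀ j (hj : j ≠ i) (hj' : j + 1 ≠ i),
      H.coe.Reachable ⟨x j, hxm j hj⟩ ⟨x (j + 1), hxm _ hj'⟩ := by
    intro j hj hj'
    have hs := step (x j) (by rwa [hgx]) (fun h => hj' (by rw [hx h]; simp))
    have h1 := toX _ (f (x j)) le_rfl (H.edge_vert hs.symm)
    simp only [hgf j] at h1
    have h2 : H.coe.Adj ⟨x j, hxm j hj⟩ ⟨f (x j), H.edge_vert hs.symm⟩ := hs
    exact h2.reachable.trans h1
  have h4 : ∀ i : Fin 4, i + 1 ≠ i ∧ i + 1 + 1 ≠ i ∧ i + 1 + 1 + 1 ≠ i ∧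
      ∀ j, j ≠ i → j = i + 1 ∨ j = i + 1 + 1 ∨ j = i + 1 + 1 + 1 := by
    decide
  obtain ⟨n1, n2, n3, hcases⟩ := h4 i
  have toRoot : ∀ v : H.verts, H.coe.Reachable v ⟨x (i + 1 + 1 + 1), hxm _ n3⟩ := by
    rintro ⟨v, hv⟩
    refine (toX _ v le_rfl hv).trans ?_
    have r2 := next _ n2 n3
    have r1 := (next _ n1 n2).trans r2
    rcases hcases (g v) hv with h | h | h <;> simp only [h]
    · exact r1
    · exact r2
    · exact Reachable.refl _
  have hconn : H.coe.Connected := by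
    have : Nonempty H.verts := ⟨⟨_, hxm _ n1⟩⟩
    exact ⟨fun a b => (toRoot a).trans (toRoot b).symm⟩
  obtain ⟨T, hTH, hTv, hT⟩ := exists_isTree_le_of_connected_coe H hconn
  refine ⟨T, ?_, hT, ?_⟩
  · rw [hTv]
    intro v hv h
    exact hi (h ▸ Finset.mem_image_of_mem g hv)
  · have key : ∀ e ∈ T.edgeSet, ∃ v ∈ ({x (i - 1), x i}ᶜ : Set V), s(v, f v) = e := by
      intro e he
      induction e with
      | _ a b =>
        obtain ⟨v, h1, h2, h⟩ := hTH.2 he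
        refine ⟨v, ?_, h⟩
        rintro (h3 | h3)
        · exact h2 h3
        · exact h1 (by rw [h3, hgx])
    intro e he e' he' hee
    obtain ⟨v, hv, rfl⟩ := key e he
    obtain ⟨w, hw, rfl⟩ := key e' he'
    simp only [hc] at hee
    rw [hφ i hv hw hee]

/-- If `f` decreases `d` outside the range of `x`, then iterating `f` leads to the range of `x`,
and `g v` is the index of the first point of the range that is met. -/
lemma exists_first_hit {V : Type*} [Fintype V] {ι : Type*} [Nonempty ι] (x : ι → V)
    (hx : Function.Injective x) (f : V → V) (d : V → ℕ)
    (hd : ∀ v, (∀ i, v ≠ x i) → d (f v) < d v) :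
    ∃ g : V → ι, (∀ i, g (x i) = i) ∧ ∀ v, (∀ i, v ≠ x i) → g (f v) = g v := by
  classical
  let F : V → V := fun v => if ∀ i, v ≠ x i then f v else v
  have hFx : ∀ i, F (x i) = x i := fun i => if_neg fun h => h i rfl
  have hFf : ∀ v, (∀ i, v ≠ x i) → F v = f v := fun v h => if_pos h
  have hfix : ∀ n i, F^[n] (x i) = x i := fun n i => Function.iterate_fixed (hFx i) n
  have hit : ∀ n v, d v ≤ n → ∃ i, F^[n] v = x i := by
    intro n
    induction n with
    | zero =>
      intro v hv
      by_contra! h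
      have := hd v h
      omega
    | succ n ih =>
      intro v hv
      by_cases h : ∀ i, v ≠ x i
      · rw [Function.iterate_succ_apply, hFf v h]
        exact ih _ (by have := hd v h; omega)
      · push Not at h
        obtain ⟨i, rfl⟩ := h
        exact ⟨i, hfix _ _⟩
  let N := Finset.univ.sup d
  choose g hgF using fun v => hit N v (Finset.le_sup (Finset.mem_univ v))
  refine ⟨g, fun i => hx ?_, fun v hv => hx ?_⟩
  · rw [← hgF, hfix]
  · rw [← hgF, ← hFf v hv, ← Function.iterate_succ_apply, Function.iterate_succ_apply', hgF, hFx]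

/-- In a connected graph, every vertex other than `u` has a neighbor closer to `u`. -/
lemma SimpleGraph.Connected.exists_adj_dist_lt {V : Type*} {G : SimpleGraph V} (hG : G.Connected)
    {u v : V} (h : v ≠ u) : ∃ w, G.Adj v w ∧ G.dist w u < G.dist v u := by
  obtain ⟨q, hq⟩ := hG.exists_walk_length_eq_dist v u
  cases q with
  | nil => exact absurd rfl h
  | cons hadj q =>
    refine ⟨_, hadj, ?_⟩
    have := dist_le q
    rw [Walk.length_cons] at hq
    omega

theorem stmt_11 {V : Type*} [Fintype V] (G : SimpleGraph V) (hG : G.Connected)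
    (r : ℕ) (hr : 4 ≤ r) (u : V) (p : G.Walk u u) (hp : p.IsCycle) (hlen : p.length = r) :
    rxk G 3 ≤ Fintype.card V - 2 := by
  classical
  subst hlen
  have inj : ∀ i j, i < p.length → j < p.length → p.getVert i = p.getVert j → i = j :=
    fun i j hi hj h => hp.getVert_injOn' (by simp only [Set.mem_ofPred_eq]; omega)
      (by simp only [Set.mem_ofPred_eq]; omega) h
  have inj' : ∀ i j, 0 < i → 0 < j → i ≤ p.length → j ≤ p.length →
      p.getVert i = p.getVert j → i = j :=
    fun i j hi hj hi' hj' h => hp.getVert_injOn ⟨hi, hi'⟩ ⟨hj, hj'⟩ h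
  have hend : p.getVert p.length = p.getVert 0 := by simp
  let x : Fin 4 → V := fun i => p.getVert i
  have hx : Function.Injective x := fun i j h =>
    Fin.ext (inj i j (by omega) (by omega) h)
  have hf : ∀ v, ∃ w, G.Adj v w ∧ (∀ j < p.length, v = p.getVert j → w = p.getVert (j + 1)) ∧
      ((∀ j < p.length, v ≠ p.getVert j) → G.dist w u < G.dist v u) := by
    intro v
    by_cases h : ∃ j < p.length, v = p.getVert j
    · obtain ⟨j, hj, rfl⟩ := h
      exact ⟨_, p.adj_getVert_succ hj, fun k hk hjk => by rw [inj j k hj hk hjk],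
        fun h => absurd rfl (h j hj)⟩
    · push Not at h
      obtain ⟨w, hw, hlt⟩ := hG.exists_adj_dist_lt (u := u) (v := v)
        (by simpa using h 0 (by omega))
      exact ⟨w, hw, fun j hj hv => absurd hv (h j hj), fun _ => hlt⟩
  choose f hadj hfc hfd using hf
  have hd : ∀ v, ∃ n : ℕ, (∀ j, 0 < j → j ≤ p.length → v = p.getVert j → n = p.length - j) ∧
      ((∀ j < p.length, v ≠ p.getVert j) → n = p.length + G.dist v u) := by
    intro v
    by_cases h : ∃ j, 0 < j ∧ j ≤ p.length ∧ v = p.getVert j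
    · obtain ⟨j, hj0, hj, rfl⟩ := h
      refine ⟨_, fun k hk hk' hjk => by rw [← inj' j k hj0 hk hj hk' hjk], fun h => ?_⟩
      rcases hj.lt_or_eq with hj | rfl
      · exact absurd rfl (h j hj)
      · exact absurd hend (h 0 (by omega))
    · push Not at h
      exact ⟨_, fun j hj hj' hv => absurd hv (h j hj hj'), fun _ => rfl⟩
  choose d hdc hdd using hd
  have hoff : ∀ v, (∀ i, v ≠ x i) → d (f v) < d v := by
    intro v hv
    by_cases h : ∃ j < p.length, v = p.getVert j
    · obtain ⟨j, hj, rfl⟩ := h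
      have hj4 : 4 ≤ j := by
        by_contra! hlt
        exact hv ⟨j, hlt⟩ rfl
      rw [hdc _ j (by omega) hj.le rfl, hdc _ (j + 1) (by omega) hj (hfc _ j hj rfl)]
      omega
    · push Not at h
      have hlt := hfd v h
      rw [hdd v h]
      by_cases hw : ∀ j < p.length, f v ≠ p.getVert j
      · rw [hdd _ hw]
        omega
      · push Not at hw
        obtain ⟨j, hj, hw⟩ := hw
        rcases Nat.eq_zero_or_pos j with rfl | hj0
        · rw [hdc _ p.length (by omega) le_rfl (hw.trans hend.symm)]
          omega
        · rw [hdc _ j hj0 hj.le hw]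
          omega
  obtain ⟨g, hgx, hg⟩ := exists_first_hit x hx f d hoff
  have hgtail : ∀ k j, 4 ≤ j → j + k = p.length → g (p.getVert j) = 0 := by
    intro k
    induction k with
    | zero =>
      rintro j - rfl
      rw [hend]
      exact hgx 0
    | succ k ih =>
      intro j hj hjk
      rw [← ih (j + 1) (by omega) (by omega), ← hfc _ j (by omega) rfl, hg]
      intro i h
      have := inj j i (by omega) (by omega) h
      omega
  refine Nat.sInf_le (exists_isRainbowColoring_of_functional G x f g d hadj hgx (fun i => ?_)
    hg hoff)
  rw [hfc (x i) i (by omega) rfl]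
  by_cases hi : (i : ℕ) = 3
  · rw [hi, hgtail (p.length - 4) 4 le_rfl (by omega), show i = 3 from Fin.ext hi]
    rfl
  · rw [← hgx (i + 1)]
    have : ((i + 1 : Fin 4) : ℕ) = i + 1 := by
      revert hi
      revert i
      decide
    simp only [x, this]
end

section
/- For the cycle $C_n$ with $n \geq 4$, $rx_3(C_n) = n - 2$. -/
open SimpleGraph

namespace SimpleGraph

/-- A set of vertices closed under adjacency is closed under reachability. -/
theorem Reachable.iff_of_adj_iff {V : Type*} {G : SimpleGraph V} {P : V → Prop}
    (hP : ∀ ⦃u v⦄, G.Adj u v → (P u ↔ P v)) {u v : V} (h : G.Reachable u v) : P u ↔ P v := by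
  obtain ⟨w⟩ := h
  induction w with
  | nil => rfl
  | cons h _ ih => exact (hP h).trans ih

theorem pathGraph_isTree (m : ℕ) : (pathGraph (m + 1)).IsTree := by
  refine ⟨pathGraph_connected m, isAcyclic_iff_forall_adj_isBridge.2 fun v w hvw hr ↦ ?_⟩
  rw [pathGraph_adj] at hvw
  have key := Reachable.iff_of_adj_iff (P := fun x : Fin (m + 1) ↦ x.val ≤ min v.val w.val)
    (fun x y hxy ↦ ?_) hr
  · dsimp only at key
    omega
  · rw [deleteEdges_adj, pathGraph_adj, Set.mem_singleton_iff, Sym2.eq_iff] at hxy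
    simp only [Fin.ext_iff] at hxy
    omega

/-- The edge of the cycle graph joining `k` to `k + 1`. -/
def cycleEdge {n : ℕ} [NeZero n] (k : Fin n) : Sym2 (Fin n) := s(k, k + 1)

theorem val_add_one_eq_ite {n : ℕ} (k : Fin (n + 2)) :
    (k + 1).val = if k.val = n + 1 then 0 else k.val + 1 := by
  simp [Fin.val_add_one, Fin.ext_iff]

theorem cycleEdge_injective (n : ℕ) :
    Function.Injective (cycleEdge : Fin (n + 3) → Sym2 (Fin (n + 3))) := by
  intro k l h
  simp only [cycleEdge, Sym2.eq_iff, Fin.ext_iff, val_add_one_eq_ite] at h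
  ext
  split_ifs at h <;> omega

theorem cycleGraph_adj_iff_add_one {n : ℕ} {u v : Fin (n + 2)} :
    (cycleGraph (n + 2)).Adj u v ↔ v = u + 1 ∨ u = v + 1 := by
  rw [cycleGraph_adj, sub_eq_iff_eq_add', sub_eq_iff_eq_add', add_comm v, add_comm u, or_comm,
    add_comm 1 u, add_comm 1 v]

/-- A connected subgraph of a cycle which misses two edges stays on one side of the cut. -/
theorem cycleGraph_subgraph_mem_Ioc_iff {n : ℕ} {T : (cycleGraph (n + 2)).Subgraph}
    (hT : T.coe.Connected) {i j : Fin (n + 2)} (hi : cycleEdge i ∉ T.edgeSet)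
    (hj : cycleEdge j ∉ T.edgeSet) {x y : Fin (n + 2)} (hx : x ∈ T.verts) (hy : y ∈ T.verts) :
    (i.val < x.val ∧ x.val ≤ j.val) ↔ (i.val < y.val ∧ y.val ≤ j.val) := by
  have step : ∀ u : Fin (n + 2), T.Adj u (u + 1) →
      ((i.val < u.val ∧ u.val ≤ j.val) ↔ (i.val < (u + 1).val ∧ (u + 1).val ≤ j.val)) := by
    intro u hu
    have hui : u.val ≠ i.val := fun h ↦ hi (Fin.ext h ▸ hu)
    have huj : u.val ≠ j.val := fun h ↦ hj (Fin.ext h ▸ hu)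
    rw [val_add_one_eq_ite]
    split_ifs <;> omega
  refine Reachable.iff_of_adj_iff (G := T.coe)
    (P := fun v ↦ i.val < v.1.val ∧ v.1.val ≤ j.val) (fun u v huv ↦ ?_)
    (hT.preconnected ⟨x, hx⟩ ⟨y, hy⟩)
  obtain h | h := cycleGraph_adj_iff_add_one.1 huv.adj_sub
  · rw [h]
    exact step _ (h ▸ huv)
  · rw [h]
    exact (step _ (h ▸ huv.symm)).symm

/-- The path `s, s + 1, …, s + m` inside the cycle graph. -/
def cycleArc {n m : ℕ} (hm : m + 1 ≤ n + 2) (s : Fin (n + 2)) :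
    Copy (pathGraph (m + 1)) (cycleGraph (n + 2)) where
  toHom :=
    { toFun := fun i ↦ s + Fin.castLE hm i
      map_rel' := by
        intro i j h
        rw [pathGraph_adj] at h
        rw [cycleGraph_adj_iff_add_one, add_assoc, add_assoc, add_right_inj, add_right_inj]
        simp only [Fin.ext_iff, val_add_one_eq_ite, Fin.val_castLE]
        split_ifs <;> omega }
  injective' := fun _ _ h ↦ Fin.castLE_injective hm (add_left_cancel h)

theorem cycleArc_toSubgraph_isTree {n m : ℕ} (hm : m + 1 ≤ n + 2) (s : Fin (n + 2)) :
    (cycleArc hm s).toSubgraph.coe.IsTree :=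
  (Iso.isTree_iff (cycleArc hm s).isoToSubgraph).1 (pathGraph_isTree m)

theorem mem_verts_cycleArc {n m : ℕ} (hm : m + 1 ≤ n + 2) {s x : Fin (n + 2)}
    (hx : (x - s).val ≤ m) : x ∈ (cycleArc hm s).toSubgraph.verts := by
  refine ⟨⟨(x - s).val, by omega⟩, trivial, ?_⟩
  change s + (x - s) = x
  simp

theorem exists_cycleEdge_of_mem_cycleArc {n m : ℕ} (hm : m + 1 ≤ n + 2) {s : Fin (n + 2)}
    {e : Sym2 (Fin (n + 2))} (he : e ∈ (cycleArc hm s).toSubgraph.edgeSet) :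
    ∃ k, cycleEdge k = e ∧ (k - s).val < m := by
  rw [Subgraph.edgeSet_map] at he
  obtain ⟨e, he, rfl⟩ := he
  induction e with | _ i j
  wlog hij : i.val + 1 = j.val generalizing i j
  · rw [Sym2.eq_swap] at he ⊢
    refine this j i he ?_
    have : j.val + 1 = i.val ∨ i.val + 1 = j.val := pathGraph_adj.1 he
    omega
  refine ⟨s + Fin.castLE hm i, ?_, by simp; omega⟩
  have : Fin.castLE hm j = Fin.castLE hm i + 1 := by
    ext
    rw [val_add_one_eq_ite, if_neg (by simp; omega)]
    simp [hij]
  change s(_, _) = s(s + Fin.castLE hm i, s + Fin.castLE hm j)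
  rw [this, add_assoc]

end SimpleGraph

/-- If `n` cyclically arranged points receive at most `n - 3` colors, the cycle can be cut into
three arcs such that any two of them together contain a repeated color. -/
theorem exists_arcs_not_injOn {n q : ℕ} (hq : q + 3 ≤ n) (d : Fin n → Fin q) :
    ∃ a b : ℕ, 0 < a ∧ a < b ∧ b < n ∧ ¬ Set.InjOn d {k | a ≤ k.val} ∧
      ¬ Set.InjOn d {k | k.val < b} ∧ ¬ Set.InjOn d {k | k.val < a ∨ b ≤ k.val} := by
  classical
  have card_bound : ∀ x y : Fin n, ¬ Set.InjOn d {k | k ≠ x ∧ k ≠ y} := by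
    intro x y h
    have h1 := Finset.card_le_card_of_injOn (s := (Finset.univ.erase x).erase y)
      (t := Finset.univ) d (by simp) (h.mono fun k hk ↦ by simp_all)
    have h2 := Finset.pred_card_le_card_erase (s := Finset.univ.erase x) (a := y)
    have h3 := Finset.pred_card_le_card_erase (s := (Finset.univ : Finset (Fin n))) (a := x)
    simp only [Finset.card_univ, Fintype.card_fin] at h1 h2 h3
    omega
  have upper_one : ¬ Set.InjOn d {k | 1 ≤ k.val} := fun h ↦
    card_bound ⟨0, by omega⟩ ⟨0, by omega⟩
      (h.mono fun k hk ↦ by simp [Fin.ext_iff] at hk ⊢; omega)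
  have lower_last : ¬ Set.InjOn d {k | k.val < n - 1} := fun h ↦
    card_bound ⟨n - 1, by omega⟩ ⟨n - 1, by omega⟩
      (h.mono fun k hk ↦ by simp [Fin.ext_iff] at hk ⊢; omega)
  have exists_lower : ∃ b, ¬ Set.InjOn d {k | k.val < b} := ⟨_, lower_last⟩
  obtain ⟨b, hb, hbmin⟩ : ∃ b, ¬ Set.InjOn d {k | k.val < b} ∧
      ∀ b' < b, Set.InjOn d {k | k.val < b'} :=
    ⟨Nat.find exists_lower, Nat.find_spec exists_lower,
      fun b' h ↦ not_not.1 (Nat.find_min exists_lower h)⟩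
  have hbn : b ≤ n - 1 := by
    by_contra h
    exact lower_last (hbmin _ (by omega))
  have hb2 : 2 ≤ b := by
    by_contra h
    refine hb fun k hk l hl _ ↦ Fin.ext ?_
    simp only [Set.mem_ofPred_eq] at hk hl
    omega
  have exists_upper : ∃ a, Set.InjOn d {k | a + 1 ≤ k.val} :=
    ⟨n, fun k hk ↦ by have := k.2; simp only [Set.mem_ofPred_eq] at hk; omega⟩
  obtain ⟨a, ha, hamin⟩ : ∃ a, Set.InjOn d {k | a + 1 ≤ k.val} ∧
      ∀ a' < a, ¬ Set.InjOn d {k | a' + 1 ≤ k.val} :=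
    ⟨Nat.find exists_upper, Nat.find_spec exists_upper, fun a' h ↦ Nat.find_min exists_upper h⟩
  have ha0 : 0 < a := by
    rcases Nat.eq_zero_or_pos a with rfl | h
    · exact absurd ha upper_one
    · exact h
  have ha' : ¬ Set.InjOn d {k | a ≤ k.val} := by
    have := hamin (a - 1) (by omega)
    rwa [Nat.sub_add_cancel ha0] at this
  by_cases hab : a < b
  · refine ⟨a, b, ha0, hab, by omega, ha', hb, fun h ↦ ?_⟩
    refine card_bound ⟨a, by omega⟩ ⟨b - 1, by omega⟩ fun k hk l hl hkl ↦ ?_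
    simp only [Set.mem_ofPred_eq, ne_eq, Fin.ext_iff] at hk hl
    by_cases h1 : a + 1 ≤ k.val ∧ a + 1 ≤ l.val
    · exact ha h1.1 h1.2 hkl
    by_cases h2 : k.val < b - 1 ∧ l.val < b - 1
    · exact hbmin (b - 1) (by omega) h2.1 h2.2 hkl
    · exact h (show _ ∨ _ by omega) (show _ ∨ _ by omega) hkl
  · exact ⟨1, b, one_pos, by omega, by omega, upper_one, hb,
      fun h ↦ ha' (h.mono fun k hk ↦ Or.inr (le_trans (by omega) hk))⟩

theorem le_of_isRainbowColoring_cycleGraph {n q : ℕ} {c : Sym2 (Fin (n + 4)) → Fin q}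
    (hc : IsRainbowColoring (cycleGraph (n + 4)) c 3) : n + 2 ≤ q := by
  by_contra hq
  obtain ⟨a, b, ha, hab, hb, h1, h2, h3⟩ :=
    exists_arcs_not_injOn (n := n + 4) (by omega) (c ∘ cycleEdge)
  obtain ⟨T, hS, hT, hinj⟩ := hc {0, ⟨a, by omega⟩, ⟨b, by omega⟩}
    (Finset.card_eq_three.2 ⟨_, _, _, by simp [Fin.ext_iff]; omega, by simp [Fin.ext_iff]; omega,
      by simp [Fin.ext_iff]; omega, rfl⟩)
  have missing : ∀ s : Set (Fin (n + 4)), ¬ Set.InjOn (c ∘ cycleEdge) s →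
      ∃ k ∈ s, cycleEdge k ∉ T.edgeSet := by
    intro s hs
    by_contra! h
    exact hs (hinj.comp (cycleEdge_injective (n + 1)).injOn h)
  obtain ⟨k₁, hk₁, hT₁⟩ := missing _ h1
  obtain ⟨k₂, hk₂, hT₂⟩ := missing _ h2
  obtain ⟨k₃, hk₃, hT₃⟩ := missing _ h3
  have h0 : (0 : Fin (n + 4)) ∈ T.verts := hS (by simp)
  have ha' : (⟨a, by omega⟩ : Fin (n + 4)) ∈ T.verts := hS (by simp)
  have hb' : (⟨b, by omega⟩ : Fin (n + 4)) ∈ T.verts := hS (by simp)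
  have cut : ∀ i j : Fin (n + 4), cycleEdge i ∉ T.edgeSet → cycleEdge j ∉ T.edgeSet →
      ¬ (i.val < a ∧ a ≤ j.val) ∧ ¬ (i.val < b ∧ b ≤ j.val) := by
    intro i j hi hj
    have e₁ := cycleGraph_subgraph_mem_Ioc_iff hT.connected hi hj h0 ha'
    have e₂ := cycleGraph_subgraph_mem_Ioc_iff hT.connected hi hj h0 hb'
    simp only [Fin.val_zero] at e₁ e₂
    omega
  have c₂₁ := cut k₂ k₁ hT₂ hT₁
  have c₂₃ := cut k₂ k₃ hT₂ hT₃
  have c₃₁ := cut k₃ k₁ hT₃ hT₁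
  simp only [Set.mem_ofPred_eq] at hk₁ hk₂ hk₃
  omega

/-- Number the edges of the cycle `0, …, n + 3` in order and color them modulo `n + 2`. -/
theorem exists_isRainbowColoring_cycleGraph (n : ℕ) :
    ∃ c : Sym2 (Fin (n + 4)) → Fin (n + 2), IsRainbowColoring (cycleGraph (n + 4)) c 3 := by
  let c : Sym2 (Fin (n + 4)) → Fin (n + 2) :=
    Function.extend cycleEdge (fun k ↦ Fin.ofNat (n + 2) k.val) fun _ ↦ 0
  have color_inj : ∀ k l : Fin (n + 4), c (cycleEdge k) = c (cycleEdge l) → k.val < l.val →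
      k.val < 2 ∧ l.val = k.val + (n + 2) := by
    intro k l h hkl
    simp only [c, (cycleEdge_injective (n + 1)).extend_apply, Fin.ext_iff, Fin.val_ofNat] at h
    have hdvd : n + 2 ∣ l.val - k.val := (Nat.modEq_iff_dvd' hkl.le).1 h
    obtain ⟨t, ht⟩ := hdvd
    have : t = 1 := by
      rcases t with _ | _ | t
      · omega
      · rfl
      · have := l.2
        have : l.val - k.val ≤ l.val := Nat.sub_le _ _
        nlinarith
    subst this
    omega
  have arc_rainbow : ∀ {m : ℕ} (hm : m + 1 ≤ n + 4) (s : Fin (n + 4)),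
      (∀ k l : Fin (n + 4), (k - s).val < m → (l - s).val < m → k.val < 2 →
        l.val ≠ k.val + (n + 2)) →
      Set.InjOn c (cycleArc hm s).toSubgraph.edgeSet := by
    intro m hm s h e he f hf hef
    obtain ⟨k, rfl, hk⟩ := exists_cycleEdge_of_mem_cycleArc hm he
    obtain ⟨l, rfl, hl⟩ := exists_cycleEdge_of_mem_cycleArc hm hf
    rcases lt_trichotomy k.val l.val with hkl | hkl | hkl
    · have := color_inj k l hef hkl
      exact absurd this.2 (h k l hk hl this.1)
    · rw [Fin.ext hkl]
    · have := color_inj l k hef.symm hkl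
      exact absurd this.2 (h l k hl hk this.1)
  have val_sub : ∀ k s : Fin (n + 4),
      (k - s).val = if s.val ≤ k.val then k.val - s.val else k.val + (n + 4) - s.val := by
    intro k s
    split_ifs with h
    · exact Fin.sub_val_of_le h
    · rw [Fin.coe_sub_iff_lt.2 (not_le.1 h)]
      omega
  refine ⟨c, fun S hS ↦ ?_⟩
  by_cases hv : ∃ v ∉ S, v.val = 0 ∨ v.val = 1 ∨ v.val = n + 3
  · obtain ⟨v, hvS, hv⟩ := hv
    refine ⟨(cycleArc (m := n + 2) (by omega) (v + 1)).toSubgraph, fun x hx ↦ ?_,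
      cycleArc_toSubgraph_isTree _ _, arc_rainbow _ _ fun k l hk hl hk2 ↦ ?_⟩
    · refine mem_verts_cycleArc _ ?_
      have hxv : x.val ≠ v.val := fun h ↦ hvS (Fin.ext h ▸ hx)
      have := x.2
      rw [val_sub, val_add_one_eq_ite]
      split_ifs <;> omega
    · rw [val_sub, val_add_one_eq_ite] at hk hl
      split_ifs at hk hl <;> omega
  · push Not at hv
    let v : Fin (n + 4) := ⟨n + 3, by omega⟩
    have hSeq : ({0, 1, v} : Finset (Fin (n + 4))) = S := by
      refine Finset.eq_of_subset_of_card_le (fun x hx ↦ ?_) ?_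
      · by_contra hxS
        have := hv x hxS
        simp only [Finset.mem_insert, Finset.mem_singleton] at hx
        rcases hx with rfl | rfl | rfl <;> simp [v] at this
      · rw [hS, Finset.card_eq_three.2 ⟨0, 1, v, by simp, by simp [v, Fin.ext_iff],
          by simp [v, Fin.ext_iff], rfl⟩]
    refine ⟨(cycleArc (m := 2) (by omega) v).toSubgraph, fun x hx ↦ ?_,
      cycleArc_toSubgraph_isTree _ _, arc_rainbow _ _ fun k l hk hl hk2 ↦ ?_⟩
    · refine mem_verts_cycleArc _ ?_
      simp only [← hSeq, Finset.coe_insert, Finset.coe_singleton, Set.mem_insert_iff,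
        Set.mem_singleton_iff] at hx
      rw [val_sub]
      rcases hx with rfl | rfl | rfl <;> simp [v]
      omega
    · simp only [val_sub, v] at hk hl
      split_ifs at hk hl <;> omega

theorem stmt_14 (n : ℕ) (hn : 4 ≤ n) :
    rxk (SimpleGraph.cycleGraph n) 3 = n - 2 := by
  obtain ⟨n, rfl⟩ := Nat.exists_eq_add_of_le' hn
  exact le_antisymm (Nat.sInf_le (exists_isRainbowColoring_cycleGraph n))
    (le_csInf ⟨_, exists_isRainbowColoring_cycleGraph n⟩
      fun q ⟨_, hc⟩ ↦ le_of_isRainbowColoring_cycleGraph hc)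
end
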